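/- arXiv:2408.03883 — 3 statements merged into one kernel-verified Lean document; each statement's English description precedes it below -/
import Mathlib

section
/- (Theorem 4.1, periodised truncations) Suppose A is block-tridiagonal, i.e. A equals its tridiagonal part B (so C = 0), and that all blocks are square of equal size m (m_i = m for all i); write A^{per,t}_{n,k} := B^{per,t}_{n,k}. Then, for every n ∈ {1, …, N−1} and every t ∈ 𝕋: min_{0≤k≤N−n} ν(A^{per,t}_{n,k}) ≤ ν(A) + ε'_n(A). -/
open scoped Real

noncomputable section

namespace SpecIncl

/-- The smallest singular value of a (possibly rectangular) complex matrix,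
as the infimum of `‖F x‖` over the unit sphere. -/
noncomputable def sval {ι κ : Type*} [Fintype ι] [Fintype κ] [DecidableEq κ]
    (F : Matrix ι κ ℂ) : ℝ :=
  sInf {y : ℝ | ∃ x : EuclideanSpace ℂ κ, ‖x‖ = 1 ∧ y = ‖Matrix.toEuclideanLin F x‖}

/-- The spectral norm (2-norm) of a complex matrix. -/
noncomputable def opNorm {ι κ : Type*} [Fintype ι] [Fintype κ] [DecidableEq κ]
    (F : Matrix ι κ ℂ) : ℝ :=
  sSup {y : ℝ | ∃ x : EuclideanSpace ℂ κ, ‖x‖ = 1 ∧ y = ‖Matrix.toEuclideanLin F x‖}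

/-- The closed ε-pseudospectrum of a square complex matrix. -/
noncomputable def pspec {ι : Type*} [Fintype ι] [DecidableEq ι] (ε : ℝ)
    (E : Matrix ι ι ℂ) : Set ℂ :=
  {z : ℂ | sval (E - z • (1 : Matrix ι ι ℂ)) ≤ ε}

/-- Assemble blocks into a block matrix indexed by a sigma type. -/
def blockMat {N : ℕ} (m : Fin N → ℕ)
    (a : ∀ i j : Fin N, Matrix (Fin (m i)) (Fin (m j)) ℂ) :
    Matrix ((i : Fin N) × Fin (m i)) ((j : Fin N) × Fin (m j)) ℂ :=
  fun p q => a p.1 q.1 p.2 q.2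

/-- The block-tridiagonal part of a block matrix. -/
def triPart {N : ℕ} {m : Fin N → ℕ}
    (a : ∀ i j : Fin N, Matrix (Fin (m i)) (Fin (m j)) ℂ) :
    ∀ i j : Fin N, Matrix (Fin (m i)) (Fin (m j)) ℂ :=
  fun i j => if |(i : ℤ) - (j : ℤ)| ≤ 1 then a i j else 0

/-- The remaining (off-tridiagonal) part of a block matrix. -/
def remPart {N : ℕ} {m : Fin N → ℕ}
    (a : ∀ i j : Fin N, Matrix (Fin (m i)) (Fin (m j)) ℂ) :
    ∀ i j : Fin N, Matrix (Fin (m i)) (Fin (m j)) ℂ :=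
  fun i j => if |(i : ℤ) - (j : ℤ)| ≤ 1 then 0 else a i j

/-- r_L(A): max of the norms of the first-subdiagonal blocks. -/
noncomputable def rL {N : ℕ} {m : Fin N → ℕ}
    (a : ∀ i j : Fin N, Matrix (Fin (m i)) (Fin (m j)) ℂ) : ℝ :=
  sSup {y : ℝ | ∃ i j : Fin N, (j : ℕ) + 1 = (i : ℕ) ∧ y = opNorm (a i j)}

/-- r_U(A): max of the norms of the first-superdiagonal blocks. -/
noncomputable def rU {N : ℕ} {m : Fin N → ℕ}
    (a : ∀ i j : Fin N, Matrix (Fin (m i)) (Fin (m j)) ℂ) : ℝ :=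
  sSup {y : ℝ | ∃ i j : Fin N, (i : ℕ) + 1 = (j : ℕ) ∧ y = opNorm (a i j)}

noncomputable def rA {N : ℕ} {m : Fin N → ℕ}
    (a : ∀ i j : Fin N, Matrix (Fin (m i)) (Fin (m j)) ℂ) : ℝ :=
  rL a + rU a

/-- θ_n for the coefficient `c = r_L r_U / r²`: the unique solution of
`2 sin(t/2) cos((n+1/2)t) + c sin((n−1)t) = 0` in `[π/(2n+1), π/(n+2)]`
(by uniqueness, equal to the infimum of the solution set). -/
noncomputable def theta (c : ℝ) (n : ℕ) : ℝ :=
  sInf {t : ℝ | t ∈ Set.Icc (Real.pi / (2 * (n : ℝ) + 1)) (Real.pi / ((n : ℝ) + 2)) ∧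
    2 * Real.sin (t / 2) * Real.cos (((n : ℝ) + 1 / 2) * t)
      + c * Real.sin (((n : ℝ) - 1) * t) = 0}

/-- ε_n(A) := 2 r(A) sin(θ_n(A)/2) + ‖C‖. -/
noncomputable def epsTau {N : ℕ} {m : Fin N → ℕ}
    (a : ∀ i j : Fin N, Matrix (Fin (m i)) (Fin (m j)) ℂ) (n : ℕ) : ℝ :=
  2 * rA a * Real.sin (theta (rL a * rU a / (rA a) ^ 2) n / 2)
    + opNorm (blockMat m (remPart a))

/-- The index `k + i` in `Fin N` (0-based window of length `n` starting at `k`). -/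
def widx {N n k : ℕ} (h : k + n ≤ N) (i : Fin n) : Fin N :=
  ⟨k + i, by have := i.isLt; omega⟩

/-- The principal submatrix `B_{n,k}` of a block matrix, with block rows and
columns `k+1,…,k+n` (1-based), i.e. `k,…,k+n-1` (0-based). -/
def window {N : ℕ} {m : Fin N → ℕ}
    (b : ∀ i j : Fin N, Matrix (Fin (m i)) (Fin (m j)) ℂ)
    (n k : ℕ) (h : k + n ≤ N) :
    Matrix ((i : Fin n) × Fin (m (widx h i))) ((j : Fin n) × Fin (m (widx h j))) ℂ :=
  fun p q => b (widx h p.1) (widx h q.1) p.2 q.2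

/-- σ^n_ε(A) of the τ-method. -/
noncomputable def sigmaLow {N : ℕ} {m : Fin N → ℕ}
    (a : ∀ i j : Fin N, Matrix (Fin (m i)) (Fin (m j)) ℂ)
    (n : ℕ) (h : n ≤ N) (ε : ℝ) : Set ℂ :=
  (⋃ k : Fin (N - n + 1),
      pspec (ε + epsTau a n)
        (window (triPart a) n k (by have := k.isLt; omega))) ∪
  (⋃ m' : Fin (n - 1),
      pspec (ε + epsTau a n)
        (window (triPart a) (m' + 1) 0 (by have := m'.isLt; omega)) ∪
      pspec (ε + epsTau a n)
        (window (triPart a) (m' + 1) (N - (m' + 1)) (by have := m'.isLt; omega)))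

/-- σ̂^n_ε(A) of the τ-method. -/
noncomputable def sigmaHat {N : ℕ} {m : Fin N → ℕ}
    (a : ∀ i j : Fin N, Matrix (Fin (m i)) (Fin (m j)) ℂ)
    (n : ℕ) (h : n ≤ N) (ε : ℝ) : Set ℂ :=
  ⋃ k : Fin (N - n + 1),
    pspec (ε + epsTau a (n - 2))
      (window (triPart a) n k (by have := k.isLt; omega))

/-- The τ-method inclusion set Σ^n_ε(A). -/
noncomputable def SigmaTau {N : ℕ} {m : Fin N → ℕ}
    (a : ∀ i j : Fin N, Matrix (Fin (m i)) (Fin (m j)) ℂ)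
    (n : ℕ) (h : n ≤ N) (ε : ℝ) : Set ℂ :=
  if n ≤ 2 then sigmaLow a n h ε else sigmaLow a n h ε ∩ sigmaHat a n h ε


section ConstBlock

variable {N p : ℕ}

/-- The tridiagonal part of a block matrix with constant block size `p`,
extended by zero blocks outside the index range (0-based indices). -/
noncomputable def bTriExt (a : Fin N → Fin N → Matrix (Fin p) (Fin p) ℂ)
    (i j : ℤ) : Matrix (Fin p) (Fin p) ℂ :=
  if h : 0 ≤ i ∧ i < N ∧ 0 ≤ j ∧ j < N ∧ |i - j| ≤ 1 then
    a ⟨i.toNat, by omega⟩ ⟨j.toNat, by omega⟩ else 0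

/-- The periodised truncation `B^{per,t}_{n,k}` (0-based `k`; paper's
`B_{n,k}` has 1-based block rows/columns `k+1,…,k+n`). -/
noncomputable def Bper (a : Fin N → Fin N → Matrix (Fin p) (Fin p) ℂ)
    (n : ℕ) (k : ℤ) (t : ℂ) :
    Matrix ((_ : Fin n) × Fin p) ((_ : Fin n) × Fin p) ℂ :=
  fun q r =>
    (bTriExt a (k + q.1) (k + r.1)
      + (if (q.1 : ℕ) = 0 ∧ (r.1 : ℕ) = n - 1 then t • bTriExt a (k + n) (k + n - 1) else 0)
      + (if (q.1 : ℕ) = n - 1 ∧ (r.1 : ℕ) = 0 then (starRingEnd ℂ) t • bTriExt a (k - 1) k else 0))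
      q.2 r.2

/-- ε'_n(A) := 2 r(A) sin(π/(2n)) + ‖C‖, for a block matrix with constant
block size `p`. -/
noncomputable def epsPer (a : Fin N → Fin N → Matrix (Fin p) (Fin p) ℂ)
    (n : ℕ) : ℝ :=
  2 * rA (m := fun _ : Fin N => p) a * Real.sin (Real.pi / (2 * (n : ℝ)))
    + opNorm (blockMat (fun _ : Fin N => p) (remPart (m := fun _ : Fin N => p) a))

/-- The π-method inclusion set Π^{n,t}_ε(A). -/
noncomputable def PiMethod (a : Fin N → Fin N → Matrix (Fin p) (Fin p) ℂ)
    (n : ℕ) (t : ℂ) (ε : ℝ) : Set ℂ :=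
  ⋃ k : Fin (N - n + 1), pspec (ε + epsPer a n) (Bper a n (k : ℕ) t)

end ConstBlock

end SpecIncl


namespace SpecIncl

/-- Block `q` of a block vector. -/
def slice {n p : ℕ} (y : EuclideanSpace ℂ ((_ : Fin n) × Fin p)) (q : Fin n) :
    EuclideanSpace ℂ (Fin p) :=
  WithLp.toLp 2 fun s => y ⟨q, s⟩

lemma norm_sq_eq_sum_slice {n p : ℕ} (y : EuclideanSpace ℂ ((_ : Fin n) × Fin p)) :
    ‖y‖ ^ 2 = ∑ q, ‖slice y q‖ ^ 2 := by
  simp [EuclideanSpace.norm_sq_eq, slice, Fintype.sum_sigma]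

lemma slice_toEuclideanLin {n p : ℕ}
    (F : Matrix ((_ : Fin n) × Fin p) ((_ : Fin n) × Fin p) ℂ)
    (y : EuclideanSpace ℂ ((_ : Fin n) × Fin p)) (q : Fin n) :
    slice (Matrix.toEuclideanLin F y) q =
      ∑ r, Matrix.toEuclideanLin (Matrix.of fun s s' => F ⟨q, s⟩ ⟨r, s'⟩) (slice y r) := by
  ext s
  simp [slice, Matrix.toLpLin_apply, Matrix.mulVec, dotProduct, Fintype.sum_sigma]

lemma norm_toEuclideanLin_le {ι κ : Type*} [Fintype ι] [Fintype κ] [DecidableEq κ]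
    (F : Matrix ι κ ℂ) (x : EuclideanSpace ℂ κ) :
    ‖Matrix.toEuclideanLin F x‖ ≤ opNorm F * ‖x‖ := by
  rcases eq_or_ne x 0 with rfl | hx
  · simp
  have hx' : 0 < ‖x‖ := norm_pos_iff.2 hx
  rw [← div_le_iff₀ hx']
  refine le_csSup ⟨‖LinearMap.toContinuousLinearMap (Matrix.toEuclideanLin F)‖, ?_⟩
    ⟨((‖x‖⁻¹ : ℝ) : ℂ) • x, ?_, ?_⟩
  · rintro _ ⟨z, hz, rfl⟩
    simpa [hz] using (LinearMap.toContinuousLinearMap (Matrix.toEuclideanLin F)).le_opNorm z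
  · rw [norm_smul]; simp [hx'.ne']
  · rw [map_smul, norm_smul]; simp [div_eq_inv_mul]

lemma sval_mul_norm_le {ι κ : Type*} [Fintype ι] [Fintype κ] [DecidableEq κ]
    (F : Matrix ι κ ℂ) (x : EuclideanSpace ℂ κ) :
    sval F * ‖x‖ ≤ ‖Matrix.toEuclideanLin F x‖ := by
  rcases eq_or_ne x 0 with rfl | hx
  · simp
  have hx' : 0 < ‖x‖ := norm_pos_iff.2 hx
  rw [← le_div_iff₀ hx']
  refine csInf_le ⟨0, ?_⟩ ⟨((‖x‖⁻¹ : ℝ) : ℂ) • x, ?_, ?_⟩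
  · rintro _ ⟨z, hz, rfl⟩
    positivity
  · rw [norm_smul]; simp [hx'.ne']
  · rw [map_smul, norm_smul]; simp [div_eq_inv_mul]

lemma sval_nonneg {ι κ : Type*} [Fintype ι] [Fintype κ] [DecidableEq κ]
    (F : Matrix ι κ ℂ) : 0 ≤ sval F :=
  Real.sInf_nonneg (by rintro _ ⟨z, hz, rfl⟩; positivity)

lemma opNorm_nonneg {ι κ : Type*} [Fintype ι] [Fintype κ] [DecidableEq κ]
    (F : Matrix ι κ ℂ) : 0 ≤ opNorm F :=
  Real.sSup_nonneg (by rintro _ ⟨z, hz, rfl⟩; positivity)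

section Blocks

variable {N p : ℕ} (a : Fin N → Fin N → Matrix (Fin p) (Fin p) ℂ)

lemma rL_nonneg : 0 ≤ rL (m := fun _ => p) a :=
  Real.sSup_nonneg (by rintro _ ⟨i, j, -, rfl⟩; exact opNorm_nonneg _)

lemma rU_nonneg : 0 ≤ rU (m := fun _ => p) a :=
  Real.sSup_nonneg (by rintro _ ⟨i, j, -, rfl⟩; exact opNorm_nonneg _)

lemma opNorm_le_rL (i j : Fin N) (h : (j : ℕ) + 1 = i) :
    opNorm (a i j) ≤ rL (m := fun _ => p) a := by
  refine le_csSup (Set.Finite.bddAbove ?_) ⟨i, j, h, rfl⟩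
  refine (Set.finite_range fun ij : Fin N × Fin N => opNorm (a ij.1 ij.2)).subset ?_
  rintro _ ⟨i, j, -, rfl⟩
  exact ⟨(i, j), rfl⟩

lemma opNorm_le_rU (i j : Fin N) (h : (i : ℕ) + 1 = j) :
    opNorm (a i j) ≤ rU (m := fun _ => p) a := by
  refine le_csSup (Set.Finite.bddAbove ?_) ⟨i, j, h, rfl⟩
  refine (Set.finite_range fun ij : Fin N × Fin N => opNorm (a ij.1 ij.2)).subset ?_
  rintro _ ⟨i, j, -, rfl⟩
  exact ⟨(i, j), rfl⟩

/-- The block `b_{ij}` as a linear map. -/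
def blockLin (i j : ℤ) : EuclideanSpace ℂ (Fin p) →ₗ[ℂ] EuclideanSpace ℂ (Fin p) :=
  Matrix.toEuclideanLin (bTriExt a i j)

lemma blockLin_eq_zero {i j : ℤ}
    (h : ¬(0 ≤ i ∧ i < N ∧ 0 ≤ j ∧ j < N ∧ |i - j| ≤ 1)) : blockLin a i j = 0 := by
  simp [blockLin, bTriExt, h]

lemma norm_blockLin_lower_le (j : ℤ) (v : EuclideanSpace ℂ (Fin p)) :
    ‖blockLin a (j + 1) j v‖ ≤ rL (m := fun _ => p) a * ‖v‖ := by
  by_cases h : 0 ≤ j + 1 ∧ j + 1 < N ∧ 0 ≤ j ∧ j < N ∧ |j + 1 - j| ≤ 1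
  · simp only [blockLin, bTriExt, dif_pos h]
    refine (norm_toEuclideanLin_le _ _).trans ?_
    gcongr
    exact opNorm_le_rL a _ _ (by simp; omega)
  · rw [blockLin_eq_zero a h]
    simpa using mul_nonneg (rL_nonneg a) (norm_nonneg v)

lemma norm_blockLin_upper_le (j : ℤ) (v : EuclideanSpace ℂ (Fin p)) :
    ‖blockLin a (j - 1) j v‖ ≤ rU (m := fun _ => p) a * ‖v‖ := by
  by_cases h : 0 ≤ j - 1 ∧ j - 1 < N ∧ 0 ≤ j ∧ j < N ∧ |j - 1 - j| ≤ 1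
  · simp only [blockLin, bTriExt, dif_pos h]
    refine (norm_toEuclideanLin_le _ _).trans ?_
    gcongr
    exact opNorm_le_rU a _ _ (by simp; omega)
  · rw [blockLin_eq_zero a h]
    simpa using mul_nonneg (rU_nonneg a) (norm_nonneg v)

lemma sum_fin_eq_sum_Ico {M : Type*} [AddCommMonoid M] (n : ℕ) (k : ℤ) (f : ℤ → M) :
    ∑ q : Fin n, f (k + q) = ∑ i ∈ Finset.Ico k (k + n), f i := by
  rw [Fin.sum_univ_eq_sum_range fun q : ℕ => f (k + q)]
  refine Finset.sum_bij (fun q _ => k + (q : ℤ)) ?_ ?_ ?_ ?_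
  · intro q hq; simp at hq ⊢; omega
  · intro q _ q' _ h; simpa using h
  · intro i hi
    simp at hi
    exact ⟨(i - k).toNat, by simp; omega, by omega⟩
  · intros; rfl

lemma sum_blockLin (i c d : ℤ) (V : ℤ → EuclideanSpace ℂ (Fin p))
    (hV : ∀ j, j ∉ Finset.Ico c d → V j = 0) :
    ∑ j ∈ Finset.Ico c d, blockLin a i j (V j) =
      blockLin a i (i - 1) (V (i - 1)) + blockLin a i i (V i) +
        blockLin a i (i + 1) (V (i + 1)) := by
  have h1 : ∑ j ∈ Finset.Ico c d, blockLin a i j (V j) =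
      ∑ j ∈ Finset.Ico c d ∪ {i - 1, i, i + 1}, blockLin a i j (V j) := by
    refine Finset.sum_subset Finset.subset_union_left fun j _ hj => ?_
    rw [hV j hj, map_zero]
  have h2 : ∑ j ∈ {i - 1, i, i + 1}, blockLin a i j (V j) =
      ∑ j ∈ Finset.Ico c d ∪ {i - 1, i, i + 1}, blockLin a i j (V j) := by
    refine Finset.sum_subset Finset.subset_union_right fun j _ hj => ?_
    rw [blockLin_eq_zero, LinearMap.zero_apply]
    simp at hj
    rw [abs_le]
    omega
  rw [h1, ← h2, Finset.sum_insert (by simp; omega), Finset.sum_insert (by simp),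
    Finset.sum_singleton, add_assoc]

/-- The blocks of a block vector, extended by zero to all integer indices. -/
def extend (x : EuclideanSpace ℂ ((_ : Fin N) × Fin p)) (i : ℤ) : EuclideanSpace ℂ (Fin p) :=
  if h : 0 ≤ i ∧ i < N then slice x ⟨i.toNat, by omega⟩ else 0

lemma extend_natCast (x : EuclideanSpace ℂ ((_ : Fin N) × Fin p)) (i : Fin N) :
    extend x (i : ℕ) = slice x i := by
  simp [extend]

lemma extend_eq_zero (x : EuclideanSpace ℂ ((_ : Fin N) × Fin p)) {i : ℤ}
    (h : i ∉ Finset.Ico (0 : ℤ) N) : extend x i = 0 := by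
  simp only [Finset.mem_Ico] at h
  simp [extend, h]

lemma sum_norm_extend_sq (x : EuclideanSpace ℂ ((_ : Fin N) × Fin p)) :
    ∑ i ∈ Finset.Ico (0 : ℤ) N, ‖extend x i‖ ^ 2 = ‖x‖ ^ 2 := by
  have := sum_fin_eq_sum_Ico N 0 fun i => ‖extend x i‖ ^ 2
  simp only [zero_add] at this
  rw [← this, norm_sq_eq_sum_slice]
  simp_rw [extend_natCast]

lemma extend_blockMat (htri : ∀ i j : Fin N, 1 < |(i : ℤ) - (j : ℤ)| → a i j = 0)
    (x : EuclideanSpace ℂ ((_ : Fin N) × Fin p)) {i : ℤ} (hi : i ∈ Finset.Ico (0 : ℤ) N) :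
    extend (Matrix.toEuclideanLin (blockMat (fun _ : Fin N => p) a) x :
        EuclideanSpace ℂ ((_ : Fin N) × Fin p)) i =
      blockLin a i (i - 1) (extend x (i - 1)) + blockLin a i i (extend x i) +
        blockLin a i (i + 1) (extend x (i + 1)) := by
  rw [← sum_blockLin a i 0 N (extend x) fun j => extend_eq_zero x]
  have := sum_fin_eq_sum_Ico N 0 fun j => blockLin a i j (extend x j)
  simp only [zero_add] at this
  rw [← this]
  simp only [Finset.mem_Ico] at hi
  obtain ⟨i, rfl⟩ : ∃ i' : Fin N, i = ((i' : ℕ) : ℤ) := ⟨⟨i.toNat, by omega⟩, by simp; omega⟩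
  simp_rw [extend_natCast]
  rw [slice_toEuclideanLin]
  refine Finset.sum_congr rfl fun j _ => ?_
  congr 2
  ext s s'
  by_cases h : |(i : ℤ) - (j : ℤ)| ≤ 1
  · simp [blockMat, bTriExt, h]
  · simp [blockMat, bTriExt, h, htri i j (not_le.1 h)]

lemma slice_Bper {n : ℕ} (hn : 1 ≤ n) (k : ℤ) (t : ℂ) (V : ℤ → EuclideanSpace ℂ (Fin p))
    (hV : ∀ j, j ∉ Finset.Ico k (k + n) → V j = 0) (q : Fin n) :
    slice (Matrix.toEuclideanLin (Bper a n k t)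
        (WithLp.toLp 2 fun r : (_ : Fin n) × Fin p => V (k + r.1) r.2)) q =
      blockLin a (k + q) (k + q - 1) (V (k + q - 1)) + blockLin a (k + q) (k + q) (V (k + q)) +
        blockLin a (k + q) (k + q + 1) (V (k + q + 1)) +
        (if (q : ℕ) = 0 then t • blockLin a (k + n) (k + n - 1) (V (k + n - 1)) else 0) +
        (if (q : ℕ) = n - 1 then (starRingEnd ℂ) t • blockLin a (k - 1) k (V k) else 0) := by
  rw [← sum_blockLin a (k + q) k (k + n) V hV, ← sum_fin_eq_sum_Ico n k fun j =>
    blockLin a (k + q) j (V j), slice_toEuclideanLin]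
  have hM : ∀ r : Fin n, Matrix.toEuclideanLin
      (Matrix.of fun s s' => Bper a n k t ⟨q, s⟩ ⟨r, s'⟩) =
      blockLin a (k + q) (k + r) +
      (if (q : ℕ) = 0 ∧ (r : ℕ) = n - 1 then t • blockLin a (k + n) (k + n - 1) else 0) +
      (if (q : ℕ) = n - 1 ∧ (r : ℕ) = 0 then
        (starRingEnd ℂ) t • blockLin a (k - 1) k else 0) := by
    intro r
    have : (Matrix.of fun s s' => Bper a n k t ⟨q, s⟩ ⟨r, s'⟩) =
      (bTriExt a (k + q) (k + r)
      + (if (q : ℕ) = 0 ∧ (r : ℕ) = n - 1 then t • bTriExt a (k + n) (k + n - 1) else 0)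
      + (if (q : ℕ) = n - 1 ∧ (r : ℕ) = 0 then
          (starRingEnd ℂ) t • bTriExt a (k - 1) k else 0)) := rfl
    rw [this, map_add, map_add, apply_ite Matrix.toEuclideanLin, apply_ite Matrix.toEuclideanLin,
      map_smul, map_smul, map_zero]
    rfl
  have hs : ∀ r : Fin n, slice (WithLp.toLp 2 fun r : (_ : Fin n) × Fin p => V (k + r.1) r.2) r
      = V (k + r) := fun r => rfl
  simp_rw [hM, hs, LinearMap.add_apply, Finset.sum_add_distrib]
  congr 2
  · rw [Finset.sum_eq_single (⟨n - 1, by omega⟩ : Fin n)]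
    · have : k + ((n - 1 : ℕ) : ℤ) = k + n - 1 := by omega
      simp only [and_true, this]
      split_ifs <;> simp
    · intro r _ hr
      rw [if_neg (fun h => hr (Fin.ext h.2)), LinearMap.zero_apply]
    · simp
  · rw [Finset.sum_eq_single (⟨0, by omega⟩ : Fin n)]
    · simp only [and_true, Nat.cast_zero, add_zero]
      split_ifs <;> simp
    · intro r _ hr
      rw [if_neg (fun h => hr (Fin.ext h.2)), LinearMap.zero_apply]
    · simp

end Blocks
end SpecIncl

namespace SpecIncl

section Weights

/-- The weights `sin ((2j+1)π/(2n))`, `0 ≤ j < n`, extended by zero. -/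
def weight (n : ℕ) (j : ℤ) : ℝ :=
  if 0 ≤ j ∧ j < n then Real.sin ((2 * j + 1) * (π / (2 * n))) else 0

/-- A majorant of the squared increments of `weight`, with room at both end points for the
periodised corner entries. -/
def incr (n : ℕ) (j : ℤ) : ℝ :=
  (if 0 ≤ j ∧ j < n then 2 * Real.sin (π / (2 * n)) ^ 2 * Real.cos (2 * (j + 1) * (π / (2 * n))) ^ 2
    else 0) +
  (if 0 ≤ j + 1 ∧ j + 1 < n then
    2 * Real.sin (π / (2 * n)) ^ 2 * Real.cos (2 * (j + 1) * (π / (2 * n))) ^ 2 else 0)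

lemma sin_pi_div_two_mul_pos {n : ℕ} (hn : 1 ≤ n) : 0 < Real.sin (π / (2 * n)) := by
  have hn' : (1 : ℝ) ≤ n := by exact_mod_cast hn
  apply Real.sin_pos_of_pos_of_lt_pi (by positivity)
  rw [div_lt_iff₀ (by positivity)]
  nlinarith [Real.pi_pos]

lemma weight_eq_zero {n : ℕ} {j : ℤ} (h : ¬(0 ≤ j ∧ j < n)) : weight n j = 0 := if_neg h

lemma weight_nonneg (n : ℕ) (j : ℤ) : 0 ≤ weight n j := by
  unfold weight
  split_ifs with h
  · have h0 : (0 : ℝ) ≤ j := by exact_mod_cast h.1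
    have h1 : (j : ℝ) + 1 ≤ n := by exact_mod_cast h.2
    have hn : (0 : ℝ) < n := by linarith
    apply Real.sin_nonneg_of_nonneg_of_le_pi (by positivity)
    rw [mul_div_assoc', div_le_iff₀ (by positivity)]
    nlinarith [Real.pi_pos]
  · exact le_rfl

lemma incr_nonneg (n : ℕ) (j : ℤ) : 0 ≤ incr n j := by
  unfold incr
  split_ifs <;> positivity

lemma weight_zero {n : ℕ} (hn : 1 ≤ n) : weight n 0 = Real.sin (π / (2 * n)) := by
  have : n ≠ 0 := by omega
  simp +contextual [weight, this]

lemma weight_pred {n : ℕ} (hn : 1 ≤ n) : weight n (n - 1) = Real.sin (π / (2 * n)) := by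
  have h : (0 : ℤ) ≤ n - 1 ∧ (n : ℤ) - 1 < n := by omega
  have hn' : (n : ℝ) ≠ 0 := by positivity
  rw [weight, if_pos h, ← Real.sin_pi_sub]
  congr 1
  push_cast
  field_simp
  ring

lemma incr_neg_one {n : ℕ} (hn : 1 ≤ n) : incr n (-1) = 2 * Real.sin (π / (2 * n)) ^ 2 := by
  have : 0 < n := by omega
  simp [incr, this]

lemma incr_pred {n : ℕ} (hn : 1 ≤ n) : incr n (n - 1) = 2 * Real.sin (π / (2 * n)) ^ 2 := by
  have h : (0 : ℤ) ≤ n - 1 ∧ (n : ℤ) - 1 < n := by omega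
  have hn' : (n : ℝ) ≠ 0 := by positivity
  have e : 2 * ((((n : ℤ) - 1 : ℤ) : ℝ) + 1) * (π / (2 * n)) = π := by
    push_cast; field_simp; ring
  rw [incr, if_pos h, e]
  simp

lemma sq_weight_sub_le_incr (n : ℕ) (hn : 1 ≤ n) (j : ℤ) :
    (weight n j - weight n (j + 1)) ^ 2 ≤ incr n j := by
  by_cases h0 : 0 ≤ j
  · by_cases h1 : j + 1 < n
    · have e : weight n j - weight n (j + 1) =
          -(2 * Real.sin (π / (2 * n)) * Real.cos (2 * (j + 1) * (π / (2 * n)))) := by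
        rw [weight, weight, if_pos (by omega), if_pos (by omega), ← neg_sub, Real.sin_sub_sin]
        congr 2
        · congr 2; push_cast; ring
        · congr 1; push_cast; ring
      rw [e, incr, if_pos (by omega), if_pos (by omega)]
      apply le_of_eq; ring
    · by_cases h2 : j = n - 1
      · subst h2
        rw [incr_pred hn, weight_pred hn, weight_eq_zero (by omega)]
        nlinarith [sq_nonneg (Real.sin (π / (2 * n)))]
      · rw [weight_eq_zero (by omega), weight_eq_zero (by omega)]
        simpa using incr_nonneg n j
  · by_cases h2 : j = -1
    · subst h2
      rw [incr_neg_one hn, weight_eq_zero (by omega), neg_add_cancel, weight_zero hn]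
      nlinarith [sq_nonneg (Real.sin (π / (2 * n)))]
    · rw [weight_eq_zero (by omega), weight_eq_zero (by omega)]
      simpa using incr_nonneg n j

lemma sum_range_cos_sq_eq {n : ℕ} (hn : 1 ≤ n) :
    ∑ j ∈ Finset.range n, Real.cos (2 * j * (π / (2 * n))) ^ 2 =
      ∑ j ∈ Finset.range n, Real.sin ((2 * j + 1) * (π / (2 * n))) ^ 2 := by
  have key : ∀ (θ : ℝ) (m : ℕ), 4 * Real.sin θ *
      (∑ j ∈ Finset.range m, Real.cos (2 * j * θ) ^ 2 -
        ∑ j ∈ Finset.range m, Real.sin ((2 * j + 1) * θ) ^ 2) =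
      Real.sin ((4 * m - 1) * θ) + Real.sin θ := by
    intro θ m
    induction m with
    | zero => simp
    | succ m ih =>
      rw [Finset.sum_range_succ, Finset.sum_range_succ]
      have e1 : Real.sin ((4 * ((m + 1 : ℕ) : ℝ) - 1) * θ) =
          Real.sin (2 * m * θ + (2 * m + 1) * θ + 2 * θ) := by
        congr 1; push_cast; ring
      have e2 : Real.sin ((4 * (m : ℝ) - 1) * θ) =
          Real.sin (2 * m * θ + (2 * m + 1) * θ - 2 * θ) := by
        congr 1; ring
      have e3 : Real.cos (2 * m * θ) ^ 2 - Real.sin ((2 * m + 1) * θ) ^ 2 =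
          Real.cos (2 * m * θ + (2 * m + 1) * θ) * Real.cos θ := by
        have : Real.cos θ = Real.cos ((2 * m + 1) * θ - 2 * m * θ) := by congr 1; ring
        rw [this, Real.cos_add, Real.cos_sub]
        have h1 := Real.sin_sq_add_cos_sq (2 * m * θ)
        have h2 := Real.sin_sq_add_cos_sq ((2 * m + 1) * θ)
        linear_combination (Real.sin ((2 * m + 1) * θ) ^ 2) * h1
          - (Real.cos (2 * m * θ) ^ 2) * h2
      have e4 : Real.sin (2 * m * θ + (2 * m + 1) * θ + 2 * θ) -
          Real.sin (2 * m * θ + (2 * m + 1) * θ - 2 * θ) =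
          4 * Real.sin θ * (Real.cos (2 * m * θ + (2 * m + 1) * θ) * Real.cos θ) := by
        rw [Real.sin_add _ (2 * θ), Real.sin_sub _ (2 * θ), Real.sin_two_mul]; ring
      rw [e1]
      rw [e2] at ih
      linear_combination ih + 4 * Real.sin θ * e3 - e4
  have hn' : (1 : ℝ) ≤ n := by exact_mod_cast hn
  have hs := sin_pi_div_two_mul_pos hn
  have h := key (π / (2 * n)) n
  have e : (4 * (n : ℝ) - 1) * (π / (2 * n)) = 2 * π - π / (2 * n) := by
    field_simp; ring
  rw [e, Real.sin_two_pi_sub, neg_add_cancel] at h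
  have := (mul_eq_zero.1 h).resolve_left (by positivity)
  linarith

/-- The sum of the squared weights. -/
def weightSq (n : ℕ) : ℝ := ∑ j ∈ Finset.range n, Real.sin ((2 * j + 1) * (π / (2 * n))) ^ 2

lemma weightSq_pos {n : ℕ} (hn : 1 ≤ n) : 0 < weightSq n := by
  refine Finset.sum_pos' (fun j _ => sq_nonneg _) ⟨0, Finset.mem_range.2 hn, ?_⟩
  have := sin_pi_div_two_mul_pos hn
  simpa using pow_pos this 2

lemma sum_ite_range_eq (n : ℕ) (c : ℤ) (s : Finset ℤ) (hs : Finset.Ico c (c + n) ⊆ s) (f : ℤ → ℝ) :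
    ∑ j ∈ s, (if c ≤ j ∧ j < c + n then f j else 0) = ∑ q ∈ Finset.range n, f (c + q) := by
  rw [← Fin.sum_univ_eq_sum_range fun q : ℕ => f (c + q), sum_fin_eq_sum_Ico n c f,
    ← Finset.sum_filter]
  congr 1
  ext j
  simp only [Finset.mem_filter, Finset.mem_Ico]
  exact ⟨fun h => h.2, fun h => ⟨hs (Finset.mem_Ico.2 h), h⟩⟩

lemma sum_weight_sq (n : ℕ) (s : Finset ℤ) (hs : Finset.Ico 0 (n : ℤ) ⊆ s) :
    ∑ j ∈ s, weight n j ^ 2 = weightSq n := by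
  have := sum_ite_range_eq n 0 s (by simpa using hs)
    fun j => Real.sin ((2 * j + 1) * (π / (2 * n))) ^ 2
  simp only [zero_add, Int.cast_natCast] at this
  rw [weightSq, ← this]
  refine Finset.sum_congr rfl fun j _ => ?_
  rw [weight, ite_pow]
  simp

lemma sum_incr {n : ℕ} (hn : 1 ≤ n) (s : Finset ℤ) (hs : Finset.Ico (-1) (n : ℤ) ⊆ s) :
    ∑ j ∈ s, incr n j = 4 * Real.sin (π / (2 * n)) ^ 2 * weightSq n := by
  have h0 := sum_ite_range_eq n 0 s
    (fun j hj => hs (by simp only [Finset.mem_Ico] at hj ⊢; omega))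
    fun j => 2 * Real.sin (π / (2 * n)) ^ 2 * Real.cos (2 * (j + 1) * (π / (2 * n))) ^ 2
  have h1 := sum_ite_range_eq n (-1) s
    (fun j hj => hs (by simp only [Finset.mem_Ico] at hj ⊢; omega))
    fun j => 2 * Real.sin (π / (2 * n)) ^ 2 * Real.cos (2 * (j + 1) * (π / (2 * n))) ^ 2
  have e : ∀ j : ℤ, (-1 ≤ j ∧ j < -1 + n) ↔ (0 ≤ j + 1 ∧ j + 1 < n) := by intro j; omega
  simp only [e] at h1
  simp only [zero_add] at h0
  simp only [incr, Finset.sum_add_distrib]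
  rw [h0, h1, ← Finset.mul_sum, ← Finset.mul_sum, weightSq, ← sum_range_cos_sq_eq hn]
  have hn' : (n : ℝ) ≠ 0 := by positivity
  have hshift : ∑ i ∈ Finset.range n, Real.cos (2 * (((i : ℤ) : ℝ) + 1) * (π / (2 * n))) ^ 2 =
      ∑ i ∈ Finset.range n, Real.cos (2 * (i : ℝ) * (π / (2 * n))) ^ 2 := by
    have h2 := Finset.sum_range_succ' (fun i : ℕ => Real.cos (2 * (i : ℝ) * (π / (2 * n))) ^ 2) n
    rw [Finset.sum_range_succ] at h2
    have h3 : 2 * (n : ℝ) * (π / (2 * n)) = π := by field_simp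
    simp [h3] at h2
    simpa using h2.symm
  rw [hshift]
  push_cast
  simp only [neg_add_cancel_comm]
  ring

end Weights

/-- The start of the admissible window closest to the window starting at `k`. -/
def clamp (N n : ℕ) (k : ℤ) : ℤ := max 0 (min k (N - n))

section Corner

variable {N n : ℕ}

lemma sum_lower_sq_le (hn : 1 ≤ n) (hnN : n ≤ N) (k : ℤ) (z : ℤ → ℝ)
    (hz : ∀ i : ℤ, ¬(0 ≤ i ∧ i + 1 < N) → z i = 0) :
    ∑ i ∈ Finset.Ico (clamp N n k) (clamp N n k + n),
      (|weight n (i - 1 - k) - weight n (i - k)| * z (i - 1) +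
        if i = clamp N n k then weight n (clamp N n k + n - 1 - k) * z (clamp N n k + n - 1)
          else 0) ^ 2 ≤
      ∑ i ∈ Finset.Ico (-1) (N : ℤ), incr n (i - k) * z i ^ 2 := by
  set c := clamp N n k with hc
  have hc0 : 0 ≤ c ∧ c + n ≤ N := by simp only [clamp] at hc; omega
  have hpt : ∀ i ∈ Finset.Ico c (c + n),
      (|weight n (i - 1 - k) - weight n (i - k)| * z (i - 1) +
        if i = c then weight n (c + n - 1 - k) * z (c + n - 1) else 0) ^ 2 ≤
      incr n (i - 1 - k) * z (i - 1) ^ 2 +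
        if i = c then (if c = k then incr n (n - 1) * z (k + n - 1) ^ 2 else 0) else 0 := by
    intro i _
    have hw := sq_weight_sub_le_incr n hn (i - 1 - k)
    rw [show i - 1 - k + 1 = i - k by ring] at hw
    have hmain : (|weight n (i - 1 - k) - weight n (i - k)| * z (i - 1)) ^ 2 ≤
        incr n (i - 1 - k) * z (i - 1) ^ 2 := by
      rw [mul_pow, sq_abs]; gcongr
    split_ifs with hi hk
    · subst hi
      rw [hk, show k - 1 - k = -1 by ring, sub_self, show k + n - 1 - k = (n : ℤ) - 1 by ring,
        incr_neg_one hn, incr_pred hn, weight_zero hn, weight_pred hn,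
        weight_eq_zero (by omega), zero_sub, abs_neg]
      rw [add_sq, mul_pow, sq_abs]
      nlinarith [sq_nonneg (|Real.sin (π / (2 * n))| * z (k - 1) -
        Real.sin (π / (2 * n)) * z (k + n - 1)), sq_abs (Real.sin (π / (2 * n)))]
    · have : weight n (c + n - 1 - k) * z (c + n - 1) = 0 := by
        by_cases h : c + n < N
        · rw [weight_eq_zero (by simp only [clamp] at hc; omega), zero_mul]
        · rw [hz _ (by omega), mul_zero]
      rw [this, add_zero, add_zero]
      exact hmain
    · rw [add_zero, add_zero]
      exact hmain
  refine (Finset.sum_le_sum hpt).trans ?_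
  rw [Finset.sum_add_distrib, Finset.sum_ite_eq' (Finset.Ico c (c + n)) c,
    if_pos (by simp; omega)]
  have hshift : ∑ i ∈ Finset.Ico c (c + n), incr n (i - 1 - k) * z (i - 1) ^ 2 =
      ∑ i ∈ Finset.Ico (c - 1) (c + n - 1), incr n (i - k) * z i ^ 2 := by
    rw [← sum_fin_eq_sum_Ico, show c + n - 1 = c - 1 + n by ring, ← sum_fin_eq_sum_Ico]
    refine Finset.sum_congr rfl fun q _ => ?_
    rw [show c + (q : ℤ) - 1 = c - 1 + q by ring]
  have hnn : ∀ i, 0 ≤ incr n (i - k) * z i ^ 2 := fun i =>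
    mul_nonneg (incr_nonneg _ _) (sq_nonneg _)
  have hinsert : ∑ i ∈ insert (c + n - 1) (Finset.Ico (c - 1) (c + n - 1)),
      incr n (i - k) * z i ^ 2 ≤ ∑ i ∈ Finset.Ico (-1) (N : ℤ), incr n (i - k) * z i ^ 2 := by
    refine Finset.sum_le_sum_of_subset_of_nonneg (fun i hi => ?_) fun i _ _ => hnn i
    simp only [Finset.mem_insert, Finset.mem_Ico] at hi ⊢
    omega
  rw [Finset.sum_insert (by simp)] at hinsert
  rw [hshift]
  refine le_trans ?_ hinsert
  rw [add_comm]
  gcongr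
  split_ifs with hk
  · rw [hk, show k + n - 1 - k = (n : ℤ) - 1 by ring]
  · exact hnn _

lemma sum_upper_sq_le (hn : 1 ≤ n) (hnN : n ≤ N) (k : ℤ) (z : ℤ → ℝ)
    (hz : ∀ i : ℤ, ¬(1 ≤ i ∧ i < N) → z i = 0) :
    ∑ i ∈ Finset.Ico (clamp N n k) (clamp N n k + n),
      (|weight n (i + 1 - k) - weight n (i - k)| * z (i + 1) +
        if i = clamp N n k + n - 1 then weight n (clamp N n k - k) * z (clamp N n k)
          else 0) ^ 2 ≤
      ∑ i ∈ Finset.Ico 0 (N + 1 : ℤ), incr n (i - 1 - k) * z i ^ 2 := by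
  set c := clamp N n k with hc
  have hc0 : 0 ≤ c ∧ c + n ≤ N := by simp only [clamp] at hc; omega
  have hpt : ∀ i ∈ Finset.Ico c (c + n),
      (|weight n (i + 1 - k) - weight n (i - k)| * z (i + 1) +
        if i = c + n - 1 then weight n (c - k) * z c else 0) ^ 2 ≤
      incr n (i - k) * z (i + 1) ^ 2 +
        if i = c + n - 1 then (if c = k then incr n (-1) * z k ^ 2 else 0) else 0 := by
    intro i _
    have hw := sq_weight_sub_le_incr n hn (i - k)
    rw [show i - k + 1 = i + 1 - k by ring] at hw
    have hmain : (|weight n (i + 1 - k) - weight n (i - k)| * z (i + 1)) ^ 2 ≤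
        incr n (i - k) * z (i + 1) ^ 2 := by
      rw [abs_sub_comm, mul_pow, sq_abs]; gcongr
    split_ifs with hi hk
    · subst hi
      rw [hk, sub_self, show k + n - 1 + 1 - k = (n : ℤ) by ring,
        show k + n - 1 - k = (n : ℤ) - 1 by ring,
        incr_neg_one hn, incr_pred hn, weight_zero hn, weight_pred hn,
        weight_eq_zero (by omega), zero_sub, abs_neg]
      rw [add_sq, mul_pow, sq_abs]
      nlinarith [sq_nonneg (|Real.sin (π / (2 * n))| * z (k + n - 1 + 1) -
        Real.sin (π / (2 * n)) * z k), sq_abs (Real.sin (π / (2 * n)))]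
    · have : weight n (c - k) * z c = 0 := by
        by_cases h : 1 ≤ c
        · rw [weight_eq_zero (by simp only [clamp] at hc; omega), zero_mul]
        · rw [hz _ (by omega), mul_zero]
      rw [this, add_zero, add_zero]
      exact hmain
    · rw [add_zero, add_zero]
      exact hmain
  refine (Finset.sum_le_sum hpt).trans ?_
  rw [Finset.sum_add_distrib, Finset.sum_ite_eq' (Finset.Ico c (c + n)) (c + n - 1),
    if_pos (by simp; omega)]
  have hshift : ∑ i ∈ Finset.Ico c (c + n), incr n (i - k) * z (i + 1) ^ 2 =
      ∑ i ∈ Finset.Ico (c + 1) (c + 1 + n), incr n (i - 1 - k) * z i ^ 2 := by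
    rw [← sum_fin_eq_sum_Ico, ← sum_fin_eq_sum_Ico]
    refine Finset.sum_congr rfl fun q _ => ?_
    rw [show c + 1 + (q : ℤ) = c + q + 1 by ring, show c + (q : ℤ) + 1 - 1 = c + q by ring]
  have hnn : ∀ i, 0 ≤ incr n (i - 1 - k) * z i ^ 2 := fun i =>
    mul_nonneg (incr_nonneg _ _) (sq_nonneg _)
  have hinsert : ∑ i ∈ insert c (Finset.Ico (c + 1) (c + 1 + n)),
      incr n (i - 1 - k) * z i ^ 2 ≤
        ∑ i ∈ Finset.Ico 0 (N + 1 : ℤ), incr n (i - 1 - k) * z i ^ 2 := by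
    refine Finset.sum_le_sum_of_subset_of_nonneg (fun i hi => ?_) fun i _ _ => hnn i
    simp only [Finset.mem_insert, Finset.mem_Ico] at hi ⊢
    omega
  rw [Finset.sum_insert (by simp)] at hinsert
  rw [hshift]
  refine le_trans ?_ hinsert
  rw [add_comm]
  gcongr
  split_ifs with hk
  · rw [hk, show k - 1 - k = (-1 : ℤ) by ring]
  · exact hnn _

lemma sum_window_weight (hnN : n ≤ N) (k : ℤ) (f : ℤ → ℝ) :
    ∑ i ∈ Finset.Ico (clamp N n k) (clamp N n k + n), weight n (i - k) ^ 2 * f i =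
      ∑ i ∈ Finset.Ico 0 (N : ℤ), weight n (i - k) ^ 2 * f i := by
  refine Finset.sum_subset (fun i hi => ?_) fun i hi hi' => ?_
  · simp only [clamp, Finset.mem_Ico] at hi ⊢; omega
  · simp only [clamp, Finset.mem_Ico] at hi hi'
    rw [weight_eq_zero (by omega)]
    simp

/-- Sums over all shifts `k` of a kernel supported in `[-1, n)`. -/
lemma sum_shift (g : ℤ → ℝ) (S : ℝ) (s : Finset ℤ)
    (hg : ∀ t : Finset ℤ, Finset.Ico (-1) (n : ℤ) ⊆ t → ∑ j ∈ t, g j = S)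
    (f : ℤ → ℝ) (hs : ∀ i ∈ s, -1 ≤ i ∧ i ≤ N) :
    ∑ k ∈ Finset.Icc (-1 - n : ℤ) (N + 1), ∑ i ∈ s, g (i - k) * f i = S * ∑ i ∈ s, f i := by
  rw [Finset.sum_comm, Finset.mul_sum]
  refine Finset.sum_congr rfl fun i hi => ?_
  have := hs i hi
  rw [← Finset.sum_mul, ← hg (Finset.Icc (i - N - 1) (i + 1 + n))
    (fun j hj => by simp only [Finset.mem_Ico, Finset.mem_Icc] at hj ⊢; omega)]
  congr 1
  refine Finset.sum_bij' (fun k _ => i - k) (fun j _ => i - j) ?_ ?_ ?_ ?_ ?_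
  · intro k hk; simp only [Finset.mem_Icc] at hk ⊢; omega
  · intro k hk; simp only [Finset.mem_Icc] at hk ⊢; omega
  · intros; ring
  · intros; ring
  · intros; rfl

end Corner

lemma sum_add_add_sq_le {ι : Type*} (s : Finset ι) (d l u : ι → ℝ) {D L U : ℝ}
    (hD : 0 ≤ D) (hL : 0 ≤ L) (hU : 0 ≤ U) (hd : ∑ i ∈ s, d i ^ 2 ≤ D ^ 2)
    (hl : ∑ i ∈ s, l i ^ 2 ≤ L ^ 2) (hu : ∑ i ∈ s, u i ^ 2 ≤ U ^ 2) :
    ∑ i ∈ s, (d i + l i + u i) ^ 2 ≤ (D + L + U) ^ 2 := by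
  have cs : ∀ (f g : ι → ℝ) (F G : ℝ), 0 ≤ F → 0 ≤ G → ∑ i ∈ s, f i ^ 2 ≤ F ^ 2 →
      ∑ i ∈ s, g i ^ 2 ≤ G ^ 2 → ∑ i ∈ s, f i * g i ≤ F * G := by
    intro f g F G hF hG hf hg
    refine le_of_sq_le_sq ?_ (by positivity)
    rw [mul_pow]
    refine (Finset.sum_mul_sq_le_sq_mul_sq s f g).trans ?_
    gcongr
  have h1 := cs d l D L hD hL hd hl
  have h2 := cs d u D U hD hU hd hu
  have h3 := cs l u L U hL hU hl hu
  have e : ∑ i ∈ s, (d i + l i + u i) ^ 2 = ∑ i ∈ s, d i ^ 2 + ∑ i ∈ s, l i ^ 2 +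
      ∑ i ∈ s, u i ^ 2 + 2 * ∑ i ∈ s, d i * l i + 2 * ∑ i ∈ s, d i * u i +
      2 * ∑ i ∈ s, l i * u i := by
    simp only [Finset.mul_sum, ← Finset.sum_add_distrib]
    exact Finset.sum_congr rfl fun i _ => by ring
  rw [e]
  linarith

end SpecIncl

namespace SpecIncl

section Main

variable {N p n : ℕ} (a : Fin N → Fin N → Matrix (Fin p) (Fin p) ℂ)

/-- The weighted restriction of a block vector to the admissible window closest to `k`. -/
def testVec (n : ℕ) (x : EuclideanSpace ℂ ((_ : Fin N) × Fin p)) (k : ℤ) :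
    EuclideanSpace ℂ ((_ : Fin n) × Fin p) :=
  WithLp.toLp 2 fun r =>
    ((weight n (clamp N n k + r.1 - k) : ℂ) • extend x (clamp N n k + r.1)) r.2

lemma norm_testVec_sq (hnN : n ≤ N) (x : EuclideanSpace ℂ ((_ : Fin N) × Fin p)) (k : ℤ) :
    ‖testVec n x k‖ ^ 2 =
      ∑ i ∈ Finset.Ico 0 (N : ℤ), weight n (i - k) ^ 2 * ‖extend x i‖ ^ 2 := by
  rw [← sum_window_weight hnN k, ← sum_fin_eq_sum_Ico, norm_sq_eq_sum_slice]
  refine Finset.sum_congr rfl fun q _ => ?_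
  have : slice (testVec n x k) q =
      (weight n (clamp N n k + q - k) : ℂ) • extend x (clamp N n k + q) := rfl
  rw [this, norm_smul, mul_pow]
  simp

lemma norm_slice_Bper_le (htri : ∀ i j : Fin N, 1 < |(i : ℤ) - (j : ℤ)| → a i j = 0)
    (hn : 1 ≤ n) (hnN : n ≤ N) {t : ℂ} (ht : ‖t‖ = 1)
    (x : EuclideanSpace ℂ ((_ : Fin N) × Fin p)) (k i : ℤ) (q : Fin n)
    (hi : i = clamp N n k + q) :
    ‖slice (Matrix.toEuclideanLin (Bper a n (clamp N n k) t) (testVec n x k)) q‖ ≤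
      weight n (i - k) * ‖extend (Matrix.toEuclideanLin (blockMat (fun _ : Fin N => p) a) x :
        EuclideanSpace ℂ ((_ : Fin N) × Fin p)) i‖ +
      (|weight n (i - 1 - k) - weight n (i - k)| *
          ‖blockLin a (i - 1 + 1) (i - 1) (extend x (i - 1))‖ +
        if i = clamp N n k then weight n (clamp N n k + n - 1 - k) *
          ‖blockLin a (clamp N n k + n - 1 + 1) (clamp N n k + n - 1)
            (extend x (clamp N n k + n - 1))‖ else 0) +
      (|weight n (i + 1 - k) - weight n (i - k)| *
          ‖blockLin a (i + 1 - 1) (i + 1) (extend x (i + 1))‖ +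
        if i = clamp N n k + n - 1 then weight n (clamp N n k - k) *
          ‖blockLin a (clamp N n k - 1) (clamp N n k) (extend x (clamp N n k))‖ else 0) := by
  set c := clamp N n k with hc
  have hq := q.isLt
  have hiN : i ∈ Finset.Ico (0 : ℤ) N := by
    simp only [clamp] at hc; simp only [Finset.mem_Ico]; omega
  have hslice := slice_Bper a hn c t (fun j => (weight n (j - k) : ℂ) • extend x j)
    (fun j hj => by
      by_cases h : j ∈ Finset.Ico (0 : ℤ) N
      · rw [weight_eq_zero]
        · simp
        · simp only [clamp] at hc; simp only [Finset.mem_Ico] at h hj; omega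
      · simp [extend_eq_zero x h]) q
  have e0 : ((q : ℕ) = 0) ↔ i = c := by omega
  have e1 : ((q : ℕ) = n - 1) ↔ i = c + n - 1 := by omega
  change ‖slice (Matrix.toEuclideanLin (Bper a n c t)
    (WithLp.toLp 2 fun r : (_ : Fin n) × Fin p =>
      ((weight n (c + r.1 - k) : ℂ) • extend x (c + r.1)) r.2)) q‖ ≤ _
  rw [hslice, extend_blockMat a htri x hiN, ← hi]
  simp only [e0, e1, sub_add_cancel, add_sub_cancel_right, map_smul]
  set P := blockLin a i (i - 1) (extend x (i - 1))
  set Q := blockLin a i i (extend x i)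
  set R := blockLin a i (i + 1) (extend x (i + 1))
  set P' := blockLin a (c + n) (c + n - 1) (extend x (c + n - 1))
  set R' := blockLin a (c - 1) c (extend x c)
  have hsplit : (weight n (i - 1 - k) : ℂ) • P + (weight n (i - k) : ℂ) • Q +
      (weight n (i + 1 - k) : ℂ) • R +
      (if i = c then t • (weight n (c + n - 1 - k) : ℂ) • P' else 0) +
      (if i = c + n - 1 then (starRingEnd ℂ) t • (weight n (c - k) : ℂ) • R' else 0) =
      (weight n (i - k) : ℂ) • (P + Q + R) +
      (((weight n (i - 1 - k) - weight n (i - k) : ℝ) : ℂ) • P +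
        (if i = c then t • (weight n (c + n - 1 - k) : ℂ) • P' else 0)) +
      (((weight n (i + 1 - k) - weight n (i - k) : ℝ) : ℂ) • R +
        (if i = c + n - 1 then (starRingEnd ℂ) t • (weight n (c - k) : ℂ) • R' else 0)) := by
    push_cast
    module
  have hnorm : ∀ (r : ℝ) (v : EuclideanSpace ℂ (Fin p)), ‖(r : ℂ) • v‖ = |r| * ‖v‖ := by
    intro r v
    rw [norm_smul, Complex.norm_real, Real.norm_eq_abs]
  rw [hsplit]
  refine (norm_add₃_le).trans (add_le_add_three ?_ ?_ ?_)
  · rw [hnorm, abs_of_nonneg (weight_nonneg _ _)]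
  · refine (norm_add_le _ _).trans ?_
    rw [hnorm]
    gcongr
    split_ifs
    · rw [norm_smul, hnorm, ht, one_mul, abs_of_nonneg (weight_nonneg _ _)]
    · simp
  · refine (norm_add_le _ _).trans ?_
    rw [hnorm]
    gcongr
    split_ifs
    · rw [norm_smul, hnorm, RCLike.norm_conj, ht, one_mul, abs_of_nonneg (weight_nonneg _ _)]
    · simp

lemma sum_Ico_norm_extend_sq_eq (x : EuclideanSpace ℂ ((_ : Fin N) × Fin p)) (c d : ℤ)
    (hc : c ≤ 0) (hd : N ≤ d) :
    ∑ i ∈ Finset.Ico c d, ‖extend x i‖ ^ 2 = ‖x‖ ^ 2 := by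
  rw [← sum_norm_extend_sq]
  refine (Finset.sum_subset (fun i hi => ?_) fun i _ hi => ?_).symm
  · simp only [Finset.mem_Ico] at hi ⊢; omega
  · simp [extend_eq_zero x hi]

lemma le_norm_add_epsPer (htri : ∀ i j : Fin N, 1 < |(i : ℤ) - (j : ℤ)| → a i j = 0)
    (hn : 1 ≤ n) (hnN : n ≤ N) {t : ℂ} (ht : ‖t‖ = 1) {μ : ℝ} (hμ : 0 ≤ μ)
    (hle : ∀ k, μ ≤ sval (Bper a n (clamp N n k) t))
    (x : EuclideanSpace ℂ ((_ : Fin N) × Fin p)) (hx : ‖x‖ = 1) :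
    μ ≤ ‖(Matrix.toEuclideanLin (blockMat (fun _ : Fin N => p) a) x :
        EuclideanSpace ℂ ((_ : Fin N) × Fin p))‖ +
      2 * rA (m := fun _ : Fin N => p) a * Real.sin (π / (2 * n)) := by
  set Ax : EuclideanSpace ℂ ((_ : Fin N) × Fin p) :=
    Matrix.toEuclideanLin (blockMat (fun _ : Fin N => p) a) x with hAx
  set K := Finset.Icc (-1 - n : ℤ) (N + 1) with hK
  set s := Real.sin (π / (2 * n)) with hs
  have hs0 : 0 < s := sin_pi_div_two_mul_pos hn
  have hS := weightSq_pos hn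
  have hSq : √(weightSq n) ^ 2 = weightSq n := Real.sq_sqrt hS.le
  have hSpos : 0 < √(weightSq n) := Real.sqrt_pos.2 hS
  have hrL := rL_nonneg a
  have hrU := rU_nonneg a
  have hweight : ∀ u : Finset ℤ, Finset.Ico (-1) (n : ℤ) ⊆ u →
      ∑ j ∈ u, weight n j ^ 2 = weightSq n := fun u hu =>
    sum_weight_sq n u ((Finset.Ico_subset_Ico_left (by norm_num)).trans hu)
  have hwindow : ∀ k : ℤ, (∑ i ∈ Finset.Ico (clamp N n k) (clamp N n k + n),
      (weight n (i - k) * ‖extend Ax i‖) ^ 2) =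
      ∑ i ∈ Finset.Ico 0 (N : ℤ), weight n (i - k) ^ 2 * ‖extend Ax i‖ ^ 2 := by
    intro k
    rw [← sum_window_weight hnN k]
    simp_rw [mul_pow]
  let d : (_ : ℤ) × ℤ → ℝ := fun r => weight n (r.2 - r.1) * ‖extend Ax r.2‖
  let l : (_ : ℤ) × ℤ → ℝ := fun r =>
    |weight n (r.2 - 1 - r.1) - weight n (r.2 - r.1)| *
          ‖blockLin a (r.2 - 1 + 1) (r.2 - 1) (extend x (r.2 - 1))‖ +
        if r.2 = clamp N n r.1 then weight n (clamp N n r.1 + n - 1 - r.1) *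
          ‖blockLin a (clamp N n r.1 + n - 1 + 1) (clamp N n r.1 + n - 1)
            (extend x (clamp N n r.1 + n - 1))‖ else 0
  let u : (_ : ℤ) × ℤ → ℝ := fun r =>
    |weight n (r.2 + 1 - r.1) - weight n (r.2 - r.1)| *
          ‖blockLin a (r.2 + 1 - 1) (r.2 + 1) (extend x (r.2 + 1))‖ +
        if r.2 = clamp N n r.1 + n - 1 then weight n (clamp N n r.1 - r.1) *
          ‖blockLin a (clamp N n r.1 - 1) (clamp N n r.1) (extend x (clamp N n r.1))‖ else 0
  let I : Finset ((_ : ℤ) × ℤ) :=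
    K.sigma fun k => Finset.Ico (clamp N n k) (clamp N n k + n)
  have hd : ∑ r ∈ I, d r ^ 2 ≤ (√(weightSq n) * ‖Ax‖) ^ 2 := by
    simp only [I, d, Finset.sum_sigma, hwindow]
    rw [hK, sum_shift (n := n) (N := N) (fun j => weight n j ^ 2) _ _ hweight
      (fun i => ‖extend Ax i‖ ^ 2) (fun i hi => by simp only [Finset.mem_Ico] at hi; omega),
      sum_norm_extend_sq, mul_pow, hSq]
  have hl : ∑ r ∈ I, l r ^ 2 ≤ (√(weightSq n) * (2 * s * rL (m := fun _ : Fin N => p) a)) ^ 2 := by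
    simp only [I, l, Finset.sum_sigma]
    refine (Finset.sum_le_sum fun k _ => sum_lower_sq_le hn hnN k
      (fun i => ‖blockLin a (i + 1) i (extend x i)‖) fun i hi => ?_).trans ?_
    · rw [blockLin_eq_zero a (by omega)]; simp
    · rw [hK, sum_shift (n := n) (N := N) (incr n) _ _ (fun u => sum_incr hn u)
        (fun i => ‖blockLin a (i + 1) i (extend x i)‖ ^ 2)
        (fun i hi => by simp only [Finset.mem_Ico] at hi; omega)]
      have : ∑ i ∈ Finset.Ico (-1) (N : ℤ), ‖blockLin a (i + 1) i (extend x i)‖ ^ 2 ≤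
          rL (m := fun _ : Fin N => p) a ^ 2 := by
        calc _ ≤ ∑ i ∈ Finset.Ico (-1) (N : ℤ),
              rL (m := fun _ : Fin N => p) a ^ 2 * ‖extend x i‖ ^ 2 := by
              refine Finset.sum_le_sum fun i _ => ?_
              rw [← mul_pow]
              gcongr
              exact norm_blockLin_lower_le a i _
          _ = _ := by
              rw [← Finset.mul_sum, sum_Ico_norm_extend_sq_eq x _ _ (by norm_num) le_rfl, hx]
              ring
      rw [mul_pow, hSq]
      have := mul_le_mul_of_nonneg_left this (by positivity : 0 ≤ 4 * s ^ 2 * weightSq n)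
      linarith
  have hu : ∑ r ∈ I, u r ^ 2 ≤ (√(weightSq n) * (2 * s * rU (m := fun _ : Fin N => p) a)) ^ 2 := by
    simp only [I, u, Finset.sum_sigma]
    refine (Finset.sum_le_sum fun k _ => sum_upper_sq_le hn hnN k
      (fun i => ‖blockLin a (i - 1) i (extend x i)‖) fun i hi => ?_).trans ?_
    · rw [blockLin_eq_zero a (by omega)]; simp
    · have hincr : ∀ u : Finset ℤ, Finset.Ico (-1) (n : ℤ) ⊆ u → ∑ j ∈ u, incr n j =
        4 * s ^ 2 * weightSq n := fun u => sum_incr hn u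
      have hshift : ∑ k ∈ K, ∑ i ∈ Finset.Ico 0 (N + 1 : ℤ),
          incr n (i - 1 - k) * ‖blockLin a (i - 1) i (extend x i)‖ ^ 2 =
          ∑ k ∈ K, ∑ i ∈ Finset.Ico (-1) (N : ℤ),
          incr n (i - k) * ‖blockLin a i (i + 1) (extend x (i + 1))‖ ^ 2 := by
        refine Finset.sum_congr rfl fun k _ => ?_
        refine Finset.sum_bij' (fun i _ => i - 1) (fun i _ => i + 1) ?_ ?_ ?_ ?_ ?_
        · intro i hi; simp only [Finset.mem_Ico] at hi ⊢; omega
        · intro i hi; simp only [Finset.mem_Ico] at hi ⊢; omega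
        · intros; ring
        · intros; ring
        · intro i _; simp only [sub_add_cancel]
      rw [hshift, hK, sum_shift (n := n) (N := N) (incr n) _ _ hincr
        (fun i => ‖blockLin a i (i + 1) (extend x (i + 1))‖ ^ 2)
        (fun i hi => by simp only [Finset.mem_Ico] at hi; omega)]
      have : ∑ i ∈ Finset.Ico (-1) (N : ℤ), ‖blockLin a i (i + 1) (extend x (i + 1))‖ ^ 2 ≤
          rU (m := fun _ : Fin N => p) a ^ 2 := by
        calc _ ≤ ∑ i ∈ Finset.Ico (-1) (N : ℤ),
              rU (m := fun _ : Fin N => p) a ^ 2 * ‖extend x (i + 1)‖ ^ 2 := by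
              refine Finset.sum_le_sum fun i _ => ?_
              rw [← mul_pow]
              gcongr
              simpa using norm_blockLin_upper_le a (i + 1) (extend x (i + 1))
          _ = rU (m := fun _ : Fin N => p) a ^ 2 *
              ∑ i ∈ Finset.Ico 0 (N + 1 : ℤ), ‖extend x i‖ ^ 2 := by
              rw [← Finset.mul_sum]
              congr 1
              refine Finset.sum_bij' (fun i _ => i + 1) (fun i _ => i - 1) ?_ ?_ ?_ ?_ ?_
              · intro i hi; simp only [Finset.mem_Ico] at hi ⊢; omega
              · intro i hi; simp only [Finset.mem_Ico] at hi ⊢; omega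
              · intros; ring
              · intros; ring
              · intros; rfl
          _ = _ := by
              rw [sum_Ico_norm_extend_sq_eq x _ _ le_rfl (by omega), hx]
              ring
      rw [mul_pow, hSq]
      have := mul_le_mul_of_nonneg_left this (by positivity : 0 ≤ 4 * s ^ 2 * weightSq n)
      linarith
  have htotal := sum_add_add_sq_le I d l u (by positivity) (by positivity) (by positivity) hd hl hu
  have hlower : (√(weightSq n) * μ) ^ 2 ≤ ∑ r ∈ I, (d r + l r + u r) ^ 2 := by
    have h1 : (√(weightSq n) * μ) ^ 2 = ∑ k ∈ K, μ ^ 2 * ‖testVec n x k‖ ^ 2 := by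
      simp_rw [← Finset.mul_sum, norm_testVec_sq hnN]
      rw [hK, sum_shift (n := n) (N := N) (fun j => weight n j ^ 2) _ _ hweight
        (fun i => ‖extend x i‖ ^ 2) (fun i hi => by simp only [Finset.mem_Ico] at hi; omega),
        sum_norm_extend_sq, hx, mul_pow, hSq]
      ring
    rw [h1, Finset.sum_sigma]
    refine Finset.sum_le_sum fun k _ => ?_
    calc μ ^ 2 * ‖testVec n x k‖ ^ 2 = (μ * ‖testVec n x k‖) ^ 2 := by ring
      _ ≤ ‖Matrix.toEuclideanLin (Bper a n (clamp N n k) t) (testVec n x k)‖ ^ 2 := by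
          gcongr
          refine le_trans ?_ (sval_mul_norm_le _ _)
          gcongr
          exact hle k
      _ ≤ _ := by
          rw [norm_sq_eq_sum_slice, ← sum_fin_eq_sum_Ico]
          refine Finset.sum_le_sum fun q _ => ?_
          gcongr
          exact norm_slice_Bper_le a htri hn hnN ht x k _ q rfl
  have hfin := le_of_sq_le_sq (hlower.trans htotal) (by positivity)
  rw [← mul_add, ← mul_add] at hfin
  have := le_of_mul_le_mul_left hfin hSpos
  rw [rA]
  linarith

end Main

end SpecIncl

open SpecIncl in
/-- **Theorem 4.1 (periodised truncations).** If A is block-tridiagonal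
(C = 0) with all blocks square of equal size, then for 1 ≤ n ≤ N−1 and
t ∈ 𝕋: `min_{0≤k≤N−n} ν(A^{per,t}_{n,k}) ≤ ν(A) + ε'_n(A)`. -/
theorem nu_periodised_truncations {N p : ℕ} (hN : 1 < N) (hp : 0 < p)
    (a : Fin N → Fin N → Matrix (Fin p) (Fin p) ℂ)
    (htri : ∀ i j : Fin N, 1 < |(i : ℤ) - (j : ℤ)| → a i j = 0)
    (n : ℕ) (hn : 1 ≤ n) (hnN : n ≤ N - 1)
    (t : ℂ) (ht : ‖t‖ = 1) :
    (⨅ k : Fin (N - n + 1), sval (Bper a n (k : ℕ) t))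
      ≤ sval (blockMat (fun _ : Fin N => p) a) + epsPer a n := by
  have hNn : n ≤ N := by omega
  have hbdd : BddBelow (Set.range fun k : Fin (N - n + 1) => sval (Bper a n (k : ℕ) t)) :=
    ⟨0, by rintro _ ⟨k, rfl⟩; exact sval_nonneg _⟩
  have hle : ∀ k, (⨅ k : Fin (N - n + 1), sval (Bper a n (k : ℕ) t)) ≤
      sval (Bper a n (clamp N n k) t) := by
    intro k
    have h : 0 ≤ clamp N n k ∧ clamp N n k + n ≤ N := by simp only [clamp]; omega
    have := ciInf_le hbdd ⟨(clamp N n k).toNat, by omega⟩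
    simpa [h.1] using this
  have hμ : 0 ≤ ⨅ k : Fin (N - n + 1), sval (Bper a n (k : ℕ) t) :=
    le_ciInf fun k => sval_nonneg _
  have hC := opNorm_nonneg (blockMat (fun _ : Fin N => p) (remPart (m := fun _ : Fin N => p) a))
  rw [← sub_le_iff_le_add]
  refine le_csInf ?_ ?_
  · let e : EuclideanSpace ℂ ((_ : Fin N) × Fin p) :=
      EuclideanSpace.single ⟨⟨0, by omega⟩, ⟨0, hp⟩⟩ 1
    exact ⟨_, e, by simp [e], rfl⟩
  · rintro _ ⟨x, hx, rfl⟩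
    have := le_norm_add_epsPer a htri hn hNn ht hμ hle x hx
    rw [sub_le_iff_le_add, epsPer]
    linarith
end
end

section
/- (Formula for the smallest singular value of a shifted Jordan block) For every n ∈ ℕ and every real s ≥ 1, the equation s·sin((n+1)t) = sin(nt) has exactly one solution t = φ_n(s) in the interval [π/(2n+1), π/(n+1)), and the smallest singular value of V_n − sI_n equals √(1 + s² − 2s·cos(φ_n(s))). -/
open scoped Real

noncomputable section

namespace SpecInclJL

/-- The smallest singular value of a (possibly rectangular) complex matrix,
as the infimum of `‖F x‖` over the unit sphere. -/
noncomputable def sval {ι κ : Type*} [Fintype ι] [Fintype κ] [DecidableEq κ]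
    (F : Matrix ι κ ℂ) : ℝ :=
  sInf {y : ℝ | ∃ x : EuclideanSpace ℂ κ, ‖x‖ = 1 ∧ y = ‖Matrix.toEuclideanLin F x‖}

/-- The closed ε-pseudospectrum of a square complex matrix. -/
noncomputable def pspec {ι : Type*} [Fintype ι] [DecidableEq ι] (ε : ℝ)
    (E : Matrix ι ι ℂ) : Set ℂ :=
  {z : ℂ | sval (E - z • (1 : Matrix ι ι ℂ)) ≤ ε}

/-- The n×n Jordan block `V_n` (zero diagonal, ones on the superdiagonal). -/
def Vm (n : ℕ) : Matrix (Fin n) (Fin n) ℂ :=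
  fun i j => if (i : ℕ) + 1 = (j : ℕ) then 1 else 0

/-- The periodised Jordan block `V^{per,t}_n`: `V_n` plus the entry `t̄` in
position (n,1) (1-based); `V^{per,t}_1 = t̄`. -/
def Vper (n : ℕ) (t : ℂ) : Matrix (Fin n) (Fin n) ℂ :=
  fun i j => (if (i : ℕ) + 1 = (j : ℕ) then 1 else 0)
    + (if (i : ℕ) = n - 1 ∧ (j : ℕ) = 0 then (starRingEnd ℂ) t else 0)

/-- The (n+2)×n matrix `V⁺_n`: first row `(1,0,…,0)`, middle n rows `V_n`,
last row zero. -/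
def VP (n : ℕ) : Matrix (Fin (n + 2)) (Fin n) ℂ :=
  fun i j => if ((i : ℕ) = 0 ∧ (j : ℕ) = 0) ∨
    (1 ≤ (i : ℕ) ∧ (i : ℕ) ≤ n ∧ (j : ℕ) = (i : ℕ)) then 1 else 0

/-- The (n+2)×n matrix `Ṽ⁺_n`: zero first and last rows, middle part `V_n`. -/
def VtP (n : ℕ) : Matrix (Fin (n + 2)) (Fin n) ℂ :=
  fun i j => if 1 ≤ (i : ℕ) ∧ (i : ℕ) ≤ n ∧ (j : ℕ) = (i : ℕ) then 1 else 0

/-- The (n+2)×n matrix `I⁺_n`: middle part the identity, first and last rows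
zero. -/
def IP (n : ℕ) : Matrix (Fin (n + 2)) (Fin n) ℂ :=
  fun i j => if (i : ℕ) = (j : ℕ) + 1 then 1 else 0

/-- The closed ε-pseudospectrum of an (n+2)×n matrix `E⁺`:
`{λ : s_min(E⁺ − λ I⁺_n) ≤ ε}`. -/
noncomputable def pspecR {n : ℕ} (ε : ℝ) (E : Matrix (Fin (n + 2)) (Fin n) ℂ) :
    Set ℂ :=
  {z : ℂ | sval (E - z • IP n) ≤ ε}

/-- ε_n := 2 sin(π/(4n+2)). -/
noncomputable def epsV (n : ℕ) : ℝ := 2 * Real.sin (Real.pi / (4 * (n : ℝ) + 2))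

/-- ε'_n := 2 sin(π/(2n)). -/
noncomputable def epsV' (n : ℕ) : ℝ := 2 * Real.sin (Real.pi / (2 * (n : ℝ)))

/-- ε''_n := 2 sin(π/(2n+2)). -/
noncomputable def epsV'' (n : ℕ) : ℝ := 2 * Real.sin (Real.pi / (2 * (n : ℝ) + 2))

/-- The τ-method inclusion set `Σ^n_ε(V_N)` (independent of `N ≥ n+1`). -/
noncomputable def SigmaV (n : ℕ) (ε : ℝ) : Set ℂ :=
  if n ≤ 2 then ⋃ m : Fin n, pspec (ε + epsV n) (Vm (m + 1))
  else pspec (ε + epsV (n - 2)) (Vm n) ∩ ⋃ m : Fin n, pspec (ε + epsV n) (Vm (m + 1))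

/-- The π-method inclusion set `Π^{n,t}_ε(V_N)`. -/
noncomputable def PiV (n : ℕ) (t : ℂ) (ε : ℝ) : Set ℂ :=
  pspec (ε + epsV' n) (Vm n) ∪ pspec (ε + epsV' n) (Vper n t)

/-- The τ₁-method inclusion set `Γ^n_ε(V_N)`. -/
noncomputable def GammaV (n : ℕ) (ε : ℝ) : Set ℂ :=
  pspecR (ε + epsV'' n) (VP n) ∪ pspecR (ε + epsV'' n) (VtP n)

/-- The closed disc of radius `r` centred at the origin. -/
def cDisc (r : ℝ) : Set ℂ := {z : ℂ | ‖z‖ ≤ r}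

/-- The n×n discrete Laplacian `L_n` (zero diagonal, ones on the first sub-
and superdiagonals). -/
def Lm (n : ℕ) : Matrix (Fin n) (Fin n) ℂ :=
  fun i j => if (i : ℕ) + 1 = (j : ℕ) ∨ (j : ℕ) + 1 = (i : ℕ) then 1 else 0

/-- θ_n for the discrete Laplacian: the unique solution of
`8 sin(t/2) cos((n+1/2)t) + sin((n−1)t) = 0` in `[π/(2n+1), π/(n+2)]`
(by uniqueness, the infimum of the solution set). -/
noncomputable def thetaL (n : ℕ) : ℝ :=
  sInf {t : ℝ | t ∈ Set.Icc (Real.pi / (2 * (n : ℝ) + 1)) (Real.pi / ((n : ℝ) + 2)) ∧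
    8 * Real.sin (t / 2) * Real.cos (((n : ℝ) + 1 / 2) * t)
      + Real.sin (((n : ℝ) - 1) * t) = 0}

/-- ε_n := 4 sin(θ_n/2) for the discrete Laplacian. -/
noncomputable def epsL (n : ℕ) : ℝ := 4 * Real.sin (thetaL n / 2)

/-- ε''_n := 4 sin(π/(2n+2)) for the discrete Laplacian. -/
noncomputable def epsL'' (n : ℕ) : ℝ := 4 * Real.sin (Real.pi / (2 * (n : ℝ) + 2))

/-- The τ-method inclusion set `Σ^n_ε(L_N)` (independent of `N ≥ n+1`). -/
noncomputable def SigmaL (n : ℕ) (ε : ℝ) : Set ℂ :=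
  if n ≤ 2 then ⋃ m : Fin n, pspec (ε + epsL n) (Lm (m + 1))
  else pspec (ε + epsL (n - 2)) (Lm n) ∩ ⋃ m : Fin n, pspec (ε + epsL n) (Lm (m + 1))

/-- The (n+2)×n matrix `L⁺_n`: first row `(1,0,…,0)`, middle n rows `L_n`,
last row `(0,…,0,1)`. -/
def LP (n : ℕ) : Matrix (Fin (n + 2)) (Fin n) ℂ :=
  fun i j => if ((i : ℕ) = 0 ∧ (j : ℕ) = 0) ∨
      (1 ≤ (i : ℕ) ∧ (i : ℕ) ≤ n ∧ ((j : ℤ) = (i : ℤ) - 2 ∨ (j : ℤ) = (i : ℤ))) ∨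
      ((i : ℕ) = n + 1 ∧ (j : ℕ) + 1 = n) then 1 else 0

/-- The (n+2)×n matrix `L̃⁺_n`: first row `(1,0,…,0)`, middle n rows `L_n`,
last row zero. -/
def LtP (n : ℕ) : Matrix (Fin (n + 2)) (Fin n) ℂ :=
  fun i j => if ((i : ℕ) = 0 ∧ (j : ℕ) = 0) ∨
      (1 ≤ (i : ℕ) ∧ (i : ℕ) ≤ n ∧ ((j : ℤ) = (i : ℤ) - 2 ∨ (j : ℤ) = (i : ℤ)))
    then 1 else 0

/-- The τ₁-method inclusion set `Γ^n_ε(L_N)`. -/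
noncomputable def GammaL (N n : ℕ) (ε : ℝ) : Set ℂ :=
  if n = N - 1 then pspecR (ε + epsL'' n) (LtP n)
  else pspecR (ε + epsL'' n) (LP n) ∪ pspecR (ε + epsL'' n) (LtP n)

/-- The set `[−2,2] + ε·𝔻̄ ⊆ ℂ`. -/
def bandSet (ε : ℝ) : Set ℂ :=
  {z : ℂ | ∃ x : ℝ, x ∈ Set.Icc (-2 : ℝ) 2 ∧ ‖z - (x : ℂ)‖ ≤ ε}

end SpecInclJL

namespace SpecInclJL

/-- A discrete Picone inequality: a positive solution `u` of the three-term recurrence bounds the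
quadratic form `∑ (f (i + 1) - s * f i) ^ 2` from below. -/
lemma mul_sum_sq_le_sum_sq_sub {n : ℕ} {s c : ℝ} (hs : 0 < s) {u f : ℕ → ℝ}
    (hu : ∀ k ≤ n, 0 < u k) (hu_last : u (n + 1) = 0) (hu_init : s * u 0 = u 1)
    (hrec : ∀ k, u (k + 2) + u k = 2 * c * u (k + 1)) (hf : f n = 0) :
    (1 + s ^ 2 - 2 * s * c) * ∑ i ∈ Finset.range n, f i ^ 2
      ≤ ∑ i ∈ Finset.range n, (f (i + 1) - s * f i) ^ 2 := by
  have key : ∀ k ≤ n, (1 + s ^ 2 - 2 * s * c) * ∑ i ∈ Finset.range k, f i ^ 2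
      ≤ ∑ i ∈ Finset.range k, (f (i + 1) - s * f i) ^ 2
        + (s * u k / u (k + 1) - 1) * f k ^ 2 := by
    intro k
    induction k with
    | zero =>
      intro _
      rcases Nat.eq_zero_or_pos n with rfl | hn
      · simp [hf]
      · have : u 1 ≠ 0 := (hu 1 hn).ne'
        simp [hu_init, this]
    | succ k ih =>
      intro hk
      have ih := ih (by lia)
      rw [Finset.sum_range_succ, Finset.sum_range_succ]
      have h1 : 0 < u (k + 1) := hu _ hk
      have hcoef : s * u k / u (k + 1) - 1 + (1 + s ^ 2 - 2 * s * c)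
          = s ^ 2 - s * (u (k + 2) / u (k + 1)) := by
        have := hrec k
        field_simp
        linear_combination s * this
      have step : (s ^ 2 - s * (u (k + 2) / u (k + 1))) * f k ^ 2
          ≤ (f (k + 1) - s * f k) ^ 2
            + (s * u (k + 1) / u (k + 2) - 1) * f (k + 1) ^ 2 := by
        rcases hk.eq_or_lt with h | h
        · have h2 : u (k + 2) = 0 := by rw [← hu_last, ← h]
          have h3 : f (k + 1) = 0 := by rw [h, hf]
          rw [h2, h3]
          apply le_of_eq
          ring
        · have h2 : 0 < u (k + 2) := hu _ h
          have hsq : 0 ≤ s * u (k + 1) / u (k + 2)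
              * (f (k + 1) - u (k + 2) / u (k + 1) * f k) ^ 2 := by positivity
          refine le_of_sub_nonneg (hsq.trans_eq ?_)
          field_simp
          ring
      rw [← hcoef] at step
      linarith
  simpa [hf] using key n le_rfl

/-- The solution `u` of the recurrence attains the bound of `mul_sum_sq_le_sum_sq_sub`. -/
lemma sum_sq_sub_eq_mul_sum_sq {n : ℕ} {s c : ℝ} {u : ℕ → ℝ}
    (hu_last : u (n + 1) = 0) (hu_init : s * u 0 = u 1)
    (hrec : ∀ k, u (k + 2) + u k = 2 * c * u (k + 1)) :
    ∑ i ∈ Finset.range n, (u (i + 2) - s * u (i + 1)) ^ 2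
      = (1 + s ^ 2 - 2 * s * c) * ∑ i ∈ Finset.range n, u (i + 1) ^ 2 := by
  have key : ∀ k, ∑ i ∈ Finset.range k, (u (i + 2) - s * u (i + 1)) ^ 2
      + (s * u k - u (k + 1)) * u (k + 1)
      = (1 + s ^ 2 - 2 * s * c) * ∑ i ∈ Finset.range k, u (i + 1) ^ 2 := by
    intro k
    induction k with
    | zero => simp [hu_init]
    | succ k ih =>
      rw [Finset.sum_range_succ, Finset.sum_range_succ]
      linear_combination ih - s * u (k + 1) * hrec k
  simpa [hu_last] using key n

/-- Extension by zero of a finite vector to a sequence. -/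
def extendZero {n : ℕ} (x : Fin n → ℂ) (k : ℕ) : ℂ :=
  if h : k < n then x ⟨k, h⟩ else 0

@[simp]
lemma extendZero_val {n : ℕ} (x : Fin n → ℂ) (i : Fin n) : extendZero x i = x i := by
  simp [extendZero]

lemma extendZero_self {n : ℕ} (x : Fin n → ℂ) : extendZero x n = 0 := by
  simp [extendZero]

lemma toEuclideanLin_Vm_sub_apply {n : ℕ} (s : ℂ) (x : EuclideanSpace ℂ (Fin n)) (i : Fin n) :
    Matrix.toEuclideanLin (Vm n - s • (1 : Matrix (Fin n) (Fin n) ℂ)) x i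
      = extendZero x (i + 1) - s * extendZero x i := by
  have hV : (Vm n).mulVec x i = extendZero x (i + 1) := by
    simp only [Matrix.mulVec, dotProduct, Vm, ite_mul, one_mul, zero_mul, extendZero]
    split_ifs with h
    · rw [Finset.sum_eq_single ⟨i + 1, h⟩]
      · simp
      · intro j _ hj
        exact if_neg fun h' => hj (Fin.ext h'.symm)
      · simp
    · exact Finset.sum_eq_zero fun j _ => if_neg (by lia)
  simp [Matrix.toLpLin_apply, hV]

lemma norm_sq_eq_sum_range {n : ℕ} (x : EuclideanSpace ℂ (Fin n)) :
    ‖x‖ ^ 2 = ∑ i ∈ Finset.range n, ‖extendZero x i‖ ^ 2 := by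
  rw [EuclideanSpace.norm_sq_eq, Finset.sum_range]
  simp

lemma norm_sq_toEuclideanLin_Vm_sub {n : ℕ} (s : ℂ) (x : EuclideanSpace ℂ (Fin n)) :
    ‖Matrix.toEuclideanLin (Vm n - s • (1 : Matrix (Fin n) (Fin n) ℂ)) x‖ ^ 2
      = ∑ i ∈ Finset.range n, ‖extendZero x (i + 1) - s * extendZero x i‖ ^ 2 := by
  rw [EuclideanSpace.norm_sq_eq, Finset.sum_range]
  simp only [toEuclideanLin_Vm_sub_apply]

/-- A positive solution of the recurrence determines the smallest singular value. -/
lemma sval_Vm_sub_of_recurrence {n : ℕ} (hn : 0 < n) {s c : ℝ} (hs : 0 < s) (hc : c ≤ 1)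
    (hc' : -1 ≤ c) {u : ℕ → ℝ}
    (hu : ∀ k ≤ n, 0 < u k) (hu_last : u (n + 1) = 0) (hu_init : s * u 0 = u 1)
    (hrec : ∀ k, u (k + 2) + u k = 2 * c * u (k + 1)) :
    sval (Vm n - (s : ℂ) • (1 : Matrix (Fin n) (Fin n) ℂ))
      = Real.sqrt (1 + s ^ 2 - 2 * s * c) := by
  have hnonneg : 0 ≤ 1 + s ^ 2 - 2 * s * c := by nlinarith [sq_nonneg (1 - s)]
  refine IsLeast.csInf_eq ⟨?_, ?_⟩
  · let v : EuclideanSpace ℂ (Fin n) := WithLp.toLp 2 fun i => (u (i + 1) : ℂ)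
    have hv : ∀ k ≤ n, extendZero v k = (u (k + 1) : ℂ) := by
      intro k hk
      rcases hk.eq_or_lt with rfl | h
      · simp [extendZero, hu_last]
      · simp [extendZero, h, v]
    have hvnorm : ‖v‖ ^ 2 = ∑ i ∈ Finset.range n, u (i + 1) ^ 2 := by
      rw [norm_sq_eq_sum_range]
      refine Finset.sum_congr rfl fun i hi => ?_
      rw [hv i (Finset.mem_range.1 hi).le, Complex.norm_real, Real.norm_eq_abs, sq_abs]
    have hAv : ‖Matrix.toEuclideanLin (Vm n - (s : ℂ) • (1 : Matrix (Fin n) (Fin n) ℂ)) v‖ ^ 2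
        = (1 + s ^ 2 - 2 * s * c) * ‖v‖ ^ 2 := by
      rw [norm_sq_toEuclideanLin_Vm_sub, hvnorm,
        ← sum_sq_sub_eq_mul_sum_sq hu_last hu_init hrec]
      refine Finset.sum_congr rfl fun i hi => ?_
      have hi := Finset.mem_range.1 hi
      rw [hv i hi.le, hv (i + 1) hi, ← Complex.ofReal_mul, ← Complex.ofReal_sub,
        Complex.norm_real, Real.norm_eq_abs, sq_abs]
    have hv0 : v ≠ 0 := by
      intro h
      have h0 := hv 0 hn.le
      have : extendZero v 0 = 0 := by simp [extendZero, h]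
      rw [this] at h0
      exact (hu 1 hn).ne' (by exact_mod_cast h0.symm)
    have hpos : 0 < ‖v‖ := norm_pos_iff.2 hv0
    refine ⟨((‖v‖⁻¹ : ℝ) : ℂ) • v, ?_, ?_⟩
    · rw [norm_smul, Complex.norm_real, norm_inv, norm_norm, inv_mul_cancel₀ hpos.ne']
    · rw [map_smul, norm_smul, Complex.norm_real, norm_inv, norm_norm, eq_comm,
        inv_mul_eq_iff_eq_mul₀ hpos.ne', ← sq_eq_sq₀ (norm_nonneg _) (by positivity), hAv,
        mul_pow, Real.sq_sqrt hnonneg, mul_comm]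
  · rintro y ⟨x, hx, rfl⟩
    refine Real.sqrt_le_iff.2 ⟨norm_nonneg _, ?_⟩
    have hx2 := norm_sq_eq_sum_range x
    have hzero := extendZero_self x
    have hre := mul_sum_sq_le_sum_sq_sub hs hu hu_last hu_init hrec
      (f := fun k => (extendZero x k).re) (by simp [hzero])
    have him := mul_sum_sq_le_sum_sq_sub hs hu hu_last hu_init hrec
      (f := fun k => (extendZero x k).im) (by simp [hzero])
    rw [norm_sq_toEuclideanLin_Vm_sub]
    simp only [Complex.sq_norm, Complex.normSq_apply, ← sq, Complex.sub_re, Complex.sub_im,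
      Complex.re_ofReal_mul, Complex.im_ofReal_mul, Finset.sum_add_distrib] at hx2 ⊢
    rw [hx] at hx2
    nlinarith

lemma pos_and_mul_lt_pi_of_mem_Ico {n : ℕ} {t : ℝ}
    (ht : t ∈ Set.Ico (π / (2 * (n : ℝ) + 1)) (π / ((n : ℝ) + 1))) :
    0 < t ∧ ((n : ℝ) + 1) * t < π := by
  refine ⟨lt_of_lt_of_le (by positivity) ht.1, ?_⟩
  rw [mul_comm]
  exact (lt_div_iff₀ (by positivity)).1 ht.2

/-- The smallest singular value in terms of any root of `s sin((n+1)t) = sin(nt)` in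
`(0, π/(n+1))`. -/
lemma sval_Vm_sub_of_root {n : ℕ} (hn : 0 < n) {s t : ℝ} (hs : 0 < s) (ht : 0 < t)
    (htn : ((n : ℝ) + 1) * t < π)
    (heq : s * Real.sin (((n : ℝ) + 1) * t) = Real.sin ((n : ℝ) * t)) :
    sval (Vm n - (s : ℂ) • (1 : Matrix (Fin n) (Fin n) ℂ))
      = Real.sqrt (1 + s ^ 2 - 2 * s * Real.cos t) := by
  refine sval_Vm_sub_of_recurrence hn hs (Real.cos_le_one t) (Real.neg_one_le_cos t)
    (u := fun k => Real.sin (((n : ℝ) + 1 - k) * t)) ?_ ?_ ?_ ?_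
  · intro k hk
    have hk : (k : ℝ) ≤ n := by exact_mod_cast hk
    have hk0 : (0 : ℝ) ≤ k := k.cast_nonneg
    apply Real.sin_pos_of_pos_of_lt_pi
    · exact mul_pos (by linarith) ht
    · nlinarith
  · simp
  · simpa using heq
  · intro k
    have h1 : ((n : ℝ) + 1 - ((k + 2 : ℕ) : ℝ)) * t
        = ((n : ℝ) + 1 - ((k + 1 : ℕ) : ℝ)) * t - t := by push_cast; ring
    have h2 : ((n : ℝ) + 1 - (k : ℝ)) * t
        = ((n : ℝ) + 1 - ((k + 1 : ℕ) : ℝ)) * t + t := by push_cast; ring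
    simp only [h1, h2, Real.sin_sub, Real.sin_add]
    ring

lemma exists_root {n : ℕ} (hn : 0 < n) {s : ℝ} (hs : 1 ≤ s) :
    ∃ t ∈ Set.Ico (π / (2 * (n : ℝ) + 1)) (π / ((n : ℝ) + 1)),
      s * Real.sin (((n : ℝ) + 1) * t) = Real.sin ((n : ℝ) * t) := by
  have hn' : (0 : ℝ) < n := by exact_mod_cast hn
  have hab : π / (2 * (n : ℝ) + 1) ≤ π / ((n : ℝ) + 1) := by
    apply div_le_div_of_nonneg_left Real.pi_pos.le <;> linarith
  let g : ℝ → ℝ := fun t => s * Real.sin (((n : ℝ) + 1) * t) - Real.sin ((n : ℝ) * t)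
  have hleft : 0 ≤ g (π / (2 * (n : ℝ) + 1)) := by
    have h1 : ((n : ℝ) + 1) * (π / (2 * (n : ℝ) + 1))
        = π - (n : ℝ) * (π / (2 * (n : ℝ) + 1)) := by field_simp; ring
    have h2 : 0 ≤ Real.sin ((n : ℝ) * (π / (2 * (n : ℝ) + 1))) := by
      apply Real.sin_nonneg_of_nonneg_of_le_pi (by positivity)
      rw [← mul_div_assoc, div_le_iff₀ (by positivity)]
      nlinarith [Real.pi_pos]
    simp only [g, h1, Real.sin_pi_sub]
    nlinarith
  have hright : g (π / ((n : ℝ) + 1)) < 0 := by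
    have h1 : ((n : ℝ) + 1) * (π / ((n : ℝ) + 1)) = π := by field_simp
    have h2 : 0 < Real.sin ((n : ℝ) * (π / ((n : ℝ) + 1))) := by
      apply Real.sin_pos_of_pos_of_lt_pi (by positivity)
      rw [← mul_div_assoc, div_lt_iff₀ (by positivity)]
      nlinarith [Real.pi_pos]
    simp only [g, h1, Real.sin_pi]
    linarith
  have hg : ContinuousOn g (Set.Icc (π / (2 * (n : ℝ) + 1)) (π / ((n : ℝ) + 1))) := by
    fun_prop
  obtain ⟨t, ht, hgt⟩ := intermediate_value_Ico' hab hg ⟨hright, hleft⟩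
  exact ⟨t, ht, sub_eq_zero.1 hgt⟩

end SpecInclJL

open SpecInclJL in
/-- **Formula for the smallest singular value of a shifted Jordan block.**
For every `n ≥ 1` and real `s ≥ 1`, the equation `s sin((n+1)t) = sin(nt)`
has exactly one solution `t = φ_n(s)` in `[π/(2n+1), π/(n+1))`, and
`s_min(V_n − s I_n) = √(1 + s² − 2 s cos(φ_n(s)))`. -/
theorem jordan_smin_formula (n : ℕ) (hn : 0 < n) (s : ℝ) (hs : 1 ≤ s) :
    ∃ t : ℝ, t ∈ Set.Ico (Real.pi / (2 * (n : ℝ) + 1)) (Real.pi / ((n : ℝ) + 1)) ∧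
      s * Real.sin (((n : ℝ) + 1) * t) = Real.sin ((n : ℝ) * t) ∧
      (∀ t' : ℝ, t' ∈ Set.Ico (Real.pi / (2 * (n : ℝ) + 1)) (Real.pi / ((n : ℝ) + 1)) →
        s * Real.sin (((n : ℝ) + 1) * t') = Real.sin ((n : ℝ) * t') → t' = t) ∧
      sval (Vm n - (s : ℂ) • (1 : Matrix (Fin n) (Fin n) ℂ))
        = Real.sqrt (1 + s ^ 2 - 2 * s * Real.cos t) := by
  obtain ⟨t, ht, heq⟩ := exists_root hn hs
  have hs0 : 0 < s := by linarith
  obtain ⟨ht0, htn⟩ := pos_and_mul_lt_pi_of_mem_Ico ht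
  refine ⟨t, ht, heq, ?_, sval_Vm_sub_of_root hn hs0 ht0 htn heq⟩
  intro t' ht' heq'
  obtain ⟨ht0', htn'⟩ := pos_and_mul_lt_pi_of_mem_Ico ht'
  have hn' : (0 : ℝ) < n := by exact_mod_cast hn
  have hsqrt := (sval_Vm_sub_of_root hn hs0 ht0' htn' heq').symm.trans
    (sval_Vm_sub_of_root hn hs0 ht0 htn heq)
  have hnonneg : ∀ r : ℝ, 0 ≤ 1 + s ^ 2 - 2 * s * Real.cos r := fun r => by
    nlinarith [sq_nonneg (1 - s), Real.cos_le_one r]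
  rw [Real.sqrt_inj (hnonneg t') (hnonneg t)] at hsqrt
  refine Real.injOn_cos ⟨ht0'.le, by nlinarith⟩ ⟨ht0.le, by nlinarith⟩ ?_
  exact mul_left_cancel₀ (by positivity : 2 * s ≠ 0) (by linarith)
end
end

section
/- (Proposition 5.1, τ-method inclusion set for the Jordan block) For every integer N > 1, every n ∈ {1, …, N−1} and every ε ≥ 0: (1+ε)·𝔻̄ ⊆ Σ^n_ε(V_N) = Spec_{ε+ε_n} V_n ⊆ (1 + ε + min{ε_n, √(2 ε_n ε)})·𝔻̄; in particular Σ^n_0(V_N) = 𝔻̄. -/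
open scoped Real

noncomputable section

namespace SpecInclJL

section SmallestSingularValue

variable {ι κ : Type*} [Fintype ι] [Fintype κ] [DecidableEq κ]

lemma sval_le_norm (F : Matrix ι κ ℂ) {x : EuclideanSpace ℂ κ} (hx : ‖x‖ = 1) :
    sval F ≤ ‖Matrix.toEuclideanLin F x‖ :=
  csInf_le ⟨0, by rintro y ⟨x, -, rfl⟩; exact norm_nonneg _⟩ ⟨x, hx, rfl⟩

lemma sval_le_of_norm_le {F : Matrix ι κ ℂ} {δ : ℝ} {x : EuclideanSpace ℂ κ} (hx : x ≠ 0)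
    (h : ‖Matrix.toEuclideanLin F x‖ ≤ δ * ‖x‖) : sval F ≤ δ := by
  have hpos : 0 < ‖x‖ := norm_pos_iff.mpr hx
  have hunit : ‖((‖x‖⁻¹ : ℝ) : ℂ) • x‖ = 1 := by
    rw [norm_smul, Complex.norm_real, norm_inv, norm_norm, inv_mul_cancel₀ hpos.ne']
  refine (sval_le_norm F hunit).trans ?_
  rw [map_smul, norm_smul, Complex.norm_real, norm_inv, norm_norm, inv_mul_le_iff₀ hpos]
  linarith

lemma le_sval [Nonempty κ] {F : Matrix ι κ ℂ} {m : ℝ}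
    (h : ∀ x : EuclideanSpace ℂ κ, ‖x‖ = 1 → m ≤ ‖Matrix.toEuclideanLin F x‖) :
    m ≤ sval F := by
  refine le_csInf ?_ ?_
  · obtain ⟨k⟩ := ‹Nonempty κ›
    exact ⟨_, EuclideanSpace.single k 1, by simp, rfl⟩
  · rintro y ⟨x, hx, rfl⟩
    exact h x hx

end SmallestSingularValue

/-- The vector of the first `n` terms of a sequence. -/
def truncVec (n : ℕ) (X : ℕ → ℂ) : EuclideanSpace ℂ (Fin n) :=
  WithLp.toLp 2 fun i => X i

lemma norm_sq_truncVec (n : ℕ) (X : ℕ → ℂ) :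
    ‖truncVec n X‖ ^ 2 = ∑ j ∈ Finset.range n, ‖X j‖ ^ 2 := by
  rw [EuclideanSpace.norm_sq_eq, Finset.sum_range]
  rfl

lemma exists_eq_truncVec {n : ℕ} (x : EuclideanSpace ℂ (Fin n)) :
    ∃ X : ℕ → ℂ, (∀ j, n ≤ j → X j = 0) ∧ x = truncVec n X := by
  refine ⟨fun j => if h : j < n then x ⟨j, h⟩ else 0, fun j hj => dif_neg (by omega), ?_⟩
  ext i
  simp [truncVec]

lemma Vm_sub_mulVec {n : ℕ} (z : ℂ) {X : ℕ → ℂ} (hX : X n = 0) (i : Fin n) :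
    ((Vm n - z • (1 : Matrix (Fin n) (Fin n) ℂ)).mulVec fun i => X i) i
      = X (i + 1) - z * X i := by
  rw [Matrix.sub_mulVec, Matrix.smul_mulVec, Matrix.one_mulVec]
  simp only [Pi.sub_apply, Pi.smul_apply, smul_eq_mul, sub_left_inj]
  simp only [Matrix.mulVec, dotProduct, Vm, ite_mul, one_mul, zero_mul]
  by_cases h : (i : ℕ) + 1 < n
  · rw [Finset.sum_eq_single (⟨i + 1, h⟩ : Fin n)]
    · simp
    · intro j _ hj
      rw [if_neg]
      intro hij
      exact hj (Fin.ext hij.symm)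
    · simp
  · have hi : (i : ℕ) + 1 = n := by omega
    rw [hi, hX]
    refine Finset.sum_eq_zero fun j _ => if_neg ?_
    omega

lemma norm_sq_Vm_sub_truncVec {n : ℕ} (z : ℂ) {X : ℕ → ℂ} (hX : X n = 0) :
    ‖Matrix.toEuclideanLin (Vm n - z • (1 : Matrix (Fin n) (Fin n) ℂ)) (truncVec n X)‖ ^ 2
      = ∑ j ∈ Finset.range n, ‖X (j + 1) - z * X j‖ ^ 2 := by
  rw [EuclideanSpace.norm_sq_eq, Finset.sum_range]
  refine Finset.sum_congr rfl fun i _ => ?_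
  rw [← Vm_sub_mulVec z hX i]
  rfl

lemma pspec_Vm_mono_dim {m n : ℕ} (hm : 1 ≤ m) (hmn : m ≤ n) (δ : ℝ) :
    pspec δ (Vm m) ⊆ pspec δ (Vm n) := by
  intro z hz
  have : Nonempty (Fin m) := ⟨⟨0, hm⟩⟩
  refine le_trans (le_sval fun x hx => ?_) (show _ ≤ δ from hz)
  obtain ⟨X, hX, rfl⟩ := exists_eq_truncVec x
  have hsum : ∀ f : ℕ → ℝ, (∀ j, m ≤ j → f j = 0) →
      ∑ j ∈ Finset.range n, f j = ∑ j ∈ Finset.range m, f j := fun f hf =>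
    (Finset.sum_subset (Finset.range_mono hmn) fun j _ hj =>
      hf j (by simpa using hj)).symm
  have hnorm : ‖truncVec n X‖ = 1 := by
    rw [← hx, ← sq_eq_sq₀ (norm_nonneg _) (norm_nonneg _), norm_sq_truncVec, norm_sq_truncVec]
    exact hsum _ fun j hj => by simp [hX j hj]
  refine (sval_le_norm _ hnorm).trans_eq ?_
  rw [← sq_eq_sq₀ (norm_nonneg _) (norm_nonneg _), norm_sq_Vm_sub_truncVec z (hX n hmn),
    norm_sq_Vm_sub_truncVec z (hX m le_rfl)]
  exact hsum _ fun j hj => by simp [hX j hj, hX (j + 1) (by omega)]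

lemma pspec_mono {ι : Type*} [Fintype ι] [DecidableEq ι] (E : Matrix ι ι ℂ) {δ δ' : ℝ}
    (h : δ ≤ δ') : pspec δ E ⊆ pspec δ' E :=
  fun _ hz => le_trans (show _ ≤ δ from hz) h

/-- Half of the lowest frequency of the Dirichlet–Neumann problem on `n` points. -/
def halfFreq (n : ℕ) : ℝ := π / (4 * (n : ℝ) + 2)

lemma epsV_eq (n : ℕ) : epsV n = 2 * Real.sin (halfFreq n) := rfl

lemma halfFreq_pos (n : ℕ) : 0 < halfFreq n := by
  have := Real.pi_pos
  unfold halfFreq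
  positivity

lemma mul_halfFreq (n : ℕ) : (2 * (n : ℝ) + 1) * halfFreq n = π / 2 := by
  unfold halfFreq
  field_simp
  ring

lemma halfFreq_le_pi_div_two (n : ℕ) : halfFreq n ≤ π / 2 := by
  have h1 := mul_halfFreq n
  have h2 := mul_nonneg (Nat.cast_nonneg (α := ℝ) n) (halfFreq_pos n).le
  linarith

lemma epsV_nonneg (n : ℕ) : 0 ≤ epsV n := by
  have h1 := halfFreq_pos n
  have h2 := halfFreq_le_pi_div_two n
  have := Real.sin_nonneg_of_nonneg_of_le_pi h1.le (by linarith)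
  rw [epsV_eq]
  linarith

lemma epsV_antitone : Antitone epsV := by
  intro m n hmn
  have hle : halfFreq n ≤ halfFreq m := by
    unfold halfFreq
    have := Real.pi_pos
    gcongr
  have := Real.sin_le_sin_of_le_of_le_pi_div_two
    (by linarith [halfFreq_pos n, Real.pi_pos]) (halfFreq_le_pi_div_two m) hle
  rw [epsV_eq, epsV_eq]
  linarith

lemma cos_odd_halfFreq_pos {n k : ℕ} (hk : k < n) :
    0 < Real.cos ((2 * (k : ℝ) + 1) * halfFreq n) := by
  have hφ := halfFreq_pos n
  have hkn : (k : ℝ) < n := by exact_mod_cast hk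
  refine Real.cos_pos_of_mem_Ioo ⟨?_, ?_⟩
  · have : 0 ≤ (2 * (k : ℝ) + 1) * halfFreq n := by positivity
    linarith [Real.pi_pos]
  · rw [← mul_halfFreq n]
    gcongr

lemma sin_even_halfFreq_nonneg {n k : ℕ} (hk : k ≤ n) :
    0 ≤ Real.sin (2 * (k : ℝ) * halfFreq n) := by
  have hφ := halfFreq_pos n
  refine Real.sin_nonneg_of_nonneg_of_le_pi (by positivity) ?_
  have h1 := mul_halfFreq n
  have h2 : (k : ℝ) * halfFreq n ≤ n * halfFreq n := by gcongr
  linarith [Real.pi_pos]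

/-- The three-term recurrence of the ground state. -/
lemma cos_recurrence (φ t : ℝ) :
    Real.cos ((t - 1) * φ) + Real.cos ((t + 3) * φ)
      = (2 - (2 * Real.sin φ) ^ 2) * Real.cos ((t + 1) * φ) := by
  have h1 : (t - 1) * φ = (t + 1) * φ - 2 * φ := by ring
  have h2 : (t + 3) * φ = (t + 1) * φ + 2 * φ := by ring
  rw [h1, h2, Real.cos_sub, Real.cos_add, Real.cos_two_mul, Real.cos_sq']
  ring

/-- A discrete Wirtinger inequality on an initial segment, with the boundary term given by the
logarithmic difference of the ground state. -/
lemma partial_wirtinger {n : ℕ} (a : ℕ → ℝ) {k : ℕ} (hk : k < n) :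
    epsV n ^ 2 * ∑ j ∈ Finset.range k, a j ^ 2
      + (1 - Real.cos ((2 * (k : ℝ) - 1) * halfFreq n)
          / Real.cos ((2 * (k : ℝ) + 1) * halfFreq n)) * a k ^ 2
      ≤ ∑ j ∈ Finset.range k, (a (j + 1) - a j) ^ 2 := by
  induction k with
  | zero =>
    have h0 := (cos_odd_halfFreq_pos hk).ne'
    have h1 : Real.cos ((2 * ((0 : ℕ) : ℝ) - 1) * halfFreq n)
        = Real.cos ((2 * ((0 : ℕ) : ℝ) + 1) * halfFreq n) := by
      rw [← Real.cos_neg]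
      congr 1
      push_cast
      ring
    rw [h1, div_self h0]
    simp
  | succ k ih =>
    specialize ih (by omega)
    have hc := cos_odd_halfFreq_pos (n := n) (k := k) (by omega)
    have hd := cos_odd_halfFreq_pos hk
    have hrec := cos_recurrence (halfFreq n) (2 * (k : ℝ))
    have e1 : 2 * ((k + 1 : ℕ) : ℝ) - 1 = 2 * (k : ℝ) + 1 := by push_cast; ring
    have e2 : 2 * ((k + 1 : ℕ) : ℝ) + 1 = 2 * (k : ℝ) + 3 := by push_cast; ring
    rw [e2] at hd
    rw [e1, e2, Finset.sum_range_succ, Finset.sum_range_succ]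
    rw [← epsV_eq] at hrec
    set b := Real.cos ((2 * (k : ℝ) - 1) * halfFreq n)
    set c := Real.cos ((2 * (k : ℝ) + 1) * halfFreq n)
    set d := Real.cos ((2 * (k : ℝ) + 3) * halfFreq n)
    have hb : b / c = 2 - epsV n ^ 2 - d / c := by
      field_simp
      linarith
    rw [hb] at ih
    have hsq : (a (k + 1) - a k) ^ 2 - (1 - d / c) * a k ^ 2 - (1 - c / d) * a (k + 1) ^ 2
        = (d * a k - c * a (k + 1)) ^ 2 / (c * d) := by
      field_simp
      ring
    have hnn : 0 ≤ (d * a k - c * a (k + 1)) ^ 2 / (c * d) := by positivity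
    linarith

/-- The discrete Wirtinger inequality with a Dirichlet condition at the right end. -/
lemma wirtinger {n : ℕ} (a : ℕ → ℝ) (ha : a n = 0) :
    epsV n ^ 2 * ∑ j ∈ Finset.range n, a j ^ 2
      ≤ ∑ j ∈ Finset.range n, (a (j + 1) - a j) ^ 2 := by
  rcases n with _ | k
  · simp
  have h := partial_wirtinger (n := k + 1) a k.lt_succ_self
  have hc := cos_odd_halfFreq_pos (n := k + 1) k.lt_succ_self
  have hrec := cos_recurrence (halfFreq (k + 1)) (2 * (k : ℝ))
  have hd : Real.cos ((2 * (k : ℝ) + 3) * halfFreq (k + 1)) = 0 := by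
    rw [← Real.cos_pi_div_two, ← mul_halfFreq (k + 1)]
    congr 1
    push_cast
    ring
  rw [← epsV_eq, hd, add_zero] at hrec
  rw [hrec, mul_div_cancel_right₀ _ hc.ne'] at h
  rw [Finset.sum_range_succ, Finset.sum_range_succ, ha]
  linarith

/-- Lower bound for `V_n - z` outside the unit disc. -/
lemma lower_bound_norm_sq {n : ℕ} {z : ℂ} (hz : 1 ≤ ‖z‖) {X : ℕ → ℂ} (hX : X n = 0) :
    (epsV n ^ 2 + (‖z‖ - 1) ^ 2) * ∑ j ∈ Finset.range n, ‖X j‖ ^ 2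
      ≤ ∑ j ∈ Finset.range n, ‖X (j + 1) - z * X j‖ ^ 2 := by
  set r := ‖z‖
  set S := ∑ j ∈ Finset.range n, ‖X j‖ ^ 2
  have hw := wirtinger (n := n) (fun j => ‖X j‖) (by simp [hX])
  have hD : 0 ≤ epsV n ^ 2 * S := by positivity
  have hshift : ∑ j ∈ Finset.range n, ‖X (j + 1)‖ ^ 2 ≤ S := by
    have h1 := Finset.sum_range_succ (fun j => ‖X j‖ ^ 2) n
    have h2 := Finset.sum_range_succ' (fun j => ‖X j‖ ^ 2) n
    have h3 : ‖X n‖ ^ 2 = 0 := by simp [hX]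
    have h4 := sq_nonneg ‖X 0‖
    linarith
  calc (epsV n ^ 2 + (r - 1) ^ 2) * S
      ≤ r * ∑ j ∈ Finset.range n, (‖X (j + 1)‖ - ‖X j‖) ^ 2 + (r ^ 2 - r) * S
          + (1 - r) * ∑ j ∈ Finset.range n, ‖X (j + 1)‖ ^ 2 := by
        nlinarith
    _ = ∑ j ∈ Finset.range n, (‖X (j + 1)‖ - r * ‖X j‖) ^ 2 := by
        simp only [S, Finset.mul_sum, ← Finset.sum_add_distrib]
        exact Finset.sum_congr rfl fun j _ => by ring
    _ ≤ ∑ j ∈ Finset.range n, ‖X (j + 1) - z * X j‖ ^ 2 := by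
        refine Finset.sum_le_sum fun j _ => sq_le_sq.mpr ?_
        rw [abs_norm, ← norm_mul]
        exact abs_norm_sub_norm_le _ _

lemma sqrt_le_sval_Vm_sub {n : ℕ} (hn : 1 ≤ n) {z : ℂ} (hz : 1 ≤ ‖z‖) :
    √(epsV n ^ 2 + (‖z‖ - 1) ^ 2) ≤ sval (Vm n - z • (1 : Matrix (Fin n) (Fin n) ℂ)) := by
  have : Nonempty (Fin n) := ⟨⟨0, hn⟩⟩
  refine le_sval fun x hx => ?_
  obtain ⟨X, hX, rfl⟩ := exists_eq_truncVec x
  refine Real.sqrt_le_iff.mpr ⟨norm_nonneg _, ?_⟩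
  have h := lower_bound_norm_sq (n := n) hz (hX n le_rfl)
  rwa [← norm_sq_truncVec, hx, one_pow, mul_one, ← norm_sq_Vm_sub_truncVec z (hX n le_rfl)] at h

/-- The moduli, read from the right end, of the solution of `(V_n - z) x = y` with `|z| = r` and
`y` of the moduli of `ε_n` times the left singular vector of `V_n - 1`. -/
def pseudoMode (n : ℕ) (r : ℝ) : ℕ → ℝ
  | 0 => 0
  | k + 1 => (pseudoMode n r k + epsV n * Real.cos ((2 * (k : ℝ) + 1) * halfFreq n)) / r

lemma sin_le_pseudoMode {n : ℕ} {r : ℝ} (hr : 0 < r) (hr1 : r ≤ 1) {k : ℕ} (hk : k ≤ n) :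
    Real.sin (2 * (k : ℝ) * halfFreq n) ≤ pseudoMode n r k := by
  induction k with
  | zero => simp [pseudoMode]
  | succ k ih =>
    specialize ih (by omega)
    have hstep : Real.sin (2 * ((k + 1 : ℕ) : ℝ) * halfFreq n)
        = Real.sin (2 * (k : ℝ) * halfFreq n)
          + epsV n * Real.cos ((2 * (k : ℝ) + 1) * halfFreq n) := by
      have e1 : 2 * ((k + 1 : ℕ) : ℝ) * halfFreq n
          = (2 * (k : ℝ) + 1) * halfFreq n + halfFreq n := by push_cast; ring
      have e2 : 2 * (k : ℝ) * halfFreq n = (2 * (k : ℝ) + 1) * halfFreq n - halfFreq n := by ring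
      rw [e1, e2, Real.sin_add, Real.sin_sub, epsV_eq]
      ring
    have hnn : 0 ≤ Real.sin (2 * ((k + 1 : ℕ) : ℝ) * halfFreq n) :=
      sin_even_halfFreq_nonneg hk
    rw [pseudoMode, le_div_iff₀ hr]
    nlinarith

lemma sum_cos_sq_eq_sum_sin_sq (n : ℕ) :
    ∑ k ∈ Finset.range n, Real.cos ((2 * (k : ℝ) + 1) * halfFreq n) ^ 2
      = ∑ k ∈ Finset.range n, Real.sin (2 * ((k + 1 : ℕ) : ℝ) * halfFreq n) ^ 2 := by
  rw [← Finset.sum_range_reflect]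
  refine Finset.sum_congr rfl fun k hk => ?_
  have hk' : k + 1 ≤ n := Finset.mem_range.mp hk
  rw [← Real.cos_pi_div_two_sub, ← mul_halfFreq n]
  congr 2
  rw [Nat.sub_sub, Nat.cast_sub (by omega)]
  push_cast
  ring

/-- Every point of the closed unit disc has an `ε_n`-pseudomode of `V_n`. -/
lemma exists_pseudomode {n : ℕ} (hn : 1 ≤ n) {z : ℂ} (hz : ‖z‖ ≤ 1) :
    ∃ x : EuclideanSpace ℂ (Fin n), x ≠ 0 ∧
      ‖Matrix.toEuclideanLin (Vm n - z • (1 : Matrix (Fin n) (Fin n) ℂ)) x‖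
        ≤ epsV n * ‖x‖ := by
  suffices h : ∃ X : ℕ → ℂ, X n = 0 ∧ 0 < ∑ j ∈ Finset.range n, ‖X j‖ ^ 2 ∧
      ∑ j ∈ Finset.range n, ‖X (j + 1) - z * X j‖ ^ 2
        ≤ epsV n ^ 2 * ∑ j ∈ Finset.range n, ‖X j‖ ^ 2 by
    obtain ⟨X, hX, hpos, hle⟩ := h
    refine ⟨truncVec n X, ?_, ?_⟩
    · intro h0
      rw [← norm_sq_truncVec, h0] at hpos
      simp at hpos
    · refine le_of_sq_le_sq ?_ (mul_nonneg (epsV_nonneg n) (norm_nonneg _))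
      rwa [mul_pow, norm_sq_Vm_sub_truncVec z hX, norm_sq_truncVec]
  rcases eq_or_ne z 0 with rfl | hz0
  · refine ⟨fun j => if j = 0 then 1 else 0, if_neg (by omega), ?_, ?_⟩
    · exact Finset.sum_pos' (fun _ _ => by positivity) ⟨0, Finset.mem_range.mpr hn, by simp⟩
    · refine le_trans (le_of_eq ?_) (by positivity : (0 : ℝ) ≤ _)
      exact Finset.sum_eq_zero fun j _ => by simp
  have hr : 0 < ‖z‖ := norm_pos_iff.mpr hz0
  set r := ‖z‖ with hr_def
  set u : ℂ := z / (r : ℂ) with hu_def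
  have hrC : (r : ℂ) ≠ 0 := by exact_mod_cast hr.ne'
  have hu : ‖u‖ = 1 := by
    rw [hu_def, norm_div, Complex.norm_real, Real.norm_of_nonneg hr.le, ← hr_def,
      div_self hr.ne']
  have hzu : z = r * u := by rw [hu_def]; field_simp
  have hnorm : ∑ j ∈ Finset.range n, ‖u ^ j * (pseudoMode n r (n - j) : ℂ)‖ ^ 2
      = ∑ k ∈ Finset.range n, pseudoMode n r (k + 1) ^ 2 := by
    rw [← Finset.sum_range_reflect (fun k => pseudoMode n r (k + 1) ^ 2)]
    refine Finset.sum_congr rfl fun j hj => ?_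
    have hj' : j < n := Finset.mem_range.mp hj
    rw [norm_mul, norm_pow, hu, one_pow, one_mul, Complex.norm_real, Real.norm_eq_abs, sq_abs]
    congr 2
    omega
  have himage : ∑ j ∈ Finset.range n,
      ‖u ^ (j + 1) * (pseudoMode n r (n - (j + 1)) : ℂ)
          - z * (u ^ j * (pseudoMode n r (n - j) : ℂ))‖ ^ 2
      = epsV n ^ 2 * ∑ k ∈ Finset.range n, Real.cos ((2 * (k : ℝ) + 1) * halfFreq n) ^ 2 := by
    rw [← Finset.sum_range_reflect (fun k => Real.cos ((2 * (k : ℝ) + 1) * halfFreq n) ^ 2),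
      Finset.mul_sum]
    refine Finset.sum_congr rfl fun j hj => ?_
    have hj' : j < n := Finset.mem_range.mp hj
    obtain ⟨k, hk⟩ : ∃ k, n = j + 1 + k := ⟨n - (j + 1), by omega⟩
    have e1 : n - (j + 1) = k := by omega
    have e2 : n - j = k + 1 := by omega
    have e3 : n - 1 - j = k := by omega
    rw [e1, e2, e3]
    have hdiff : u ^ (j + 1) * (pseudoMode n r k : ℂ)
          - z * (u ^ j * (pseudoMode n r (k + 1) : ℂ))
        = u ^ (j + 1)
          * ((-(epsV n * Real.cos ((2 * (k : ℝ) + 1) * halfFreq n)) : ℝ) : ℂ) := by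
      have hmode : r * pseudoMode n r (k + 1)
          = pseudoMode n r k + epsV n * Real.cos ((2 * (k : ℝ) + 1) * halfFreq n) := by
        rw [pseudoMode, mul_div_cancel₀ _ hr.ne']
      have hmode' : -(epsV n * Real.cos ((2 * (k : ℝ) + 1) * halfFreq n))
          = pseudoMode n r k - r * pseudoMode n r (k + 1) := by linarith
      rw [hmode', hzu]
      push_cast
      ring
    rw [hdiff, norm_mul, norm_pow, hu, one_pow, one_mul, Complex.norm_real, Real.norm_eq_abs,
      sq_abs, neg_sq, mul_pow]
  have hcmp : ∑ k ∈ Finset.range n, Real.cos ((2 * (k : ℝ) + 1) * halfFreq n) ^ 2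
      ≤ ∑ k ∈ Finset.range n, pseudoMode n r (k + 1) ^ 2 := by
    rw [sum_cos_sq_eq_sum_sin_sq]
    refine Finset.sum_le_sum fun k hk => ?_
    have hk' : k + 1 ≤ n := Finset.mem_range.mp hk
    exact pow_le_pow_left₀ (sin_even_halfFreq_nonneg hk') (sin_le_pseudoMode hr hz hk') 2
  refine ⟨fun j => u ^ j * (pseudoMode n r (n - j) : ℂ), by simp [pseudoMode], ?_, ?_⟩
  · rw [hnorm]
    refine lt_of_lt_of_le (Finset.sum_pos (fun k hk => ?_) ⟨0, Finset.mem_range.mpr hn⟩) hcmp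
    exact pow_pos (cos_odd_halfFreq_pos (Finset.mem_range.mp hk)) 2
  · rw [hnorm, himage]
    gcongr

lemma cDisc_subset_pspec_Vm {n : ℕ} (hn : 1 ≤ n) {ε : ℝ} (hε : 0 ≤ ε) :
    cDisc (1 + ε) ⊆ pspec (ε + epsV n) (Vm n) := by
  intro z hz
  have hz' : ‖z‖ ≤ 1 + ε := hz
  obtain ⟨w, hw, hzw⟩ : ∃ w : ℂ, ‖w‖ ≤ 1 ∧ ‖w - z‖ ≤ ε := by
    rcases le_or_gt ‖z‖ 1 with h | h
    · exact ⟨z, h, by simpa using hε⟩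
    · have hpos : 0 < ‖z‖ := by linarith
      refine ⟨((‖z‖⁻¹ : ℝ) : ℂ) * z, ?_, ?_⟩
      · rw [norm_mul, Complex.norm_real, norm_inv, norm_norm, inv_mul_cancel₀ hpos.ne']
      · have e : ((‖z‖⁻¹ : ℝ) : ℂ) * z - z = ((‖z‖⁻¹ - 1 : ℝ) : ℂ) * z := by push_cast; ring
        have hinv : ‖z‖⁻¹ ≤ 1 := inv_le_one_of_one_le₀ h.le
        rw [e, norm_mul, Complex.norm_real, Real.norm_eq_abs, abs_of_nonpos (by linarith),
          neg_sub, sub_mul, inv_mul_cancel₀ hpos.ne']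
        linarith
  obtain ⟨x, hx0, hx⟩ := exists_pseudomode hn hw
  refine sval_le_of_norm_le hx0 ?_
  have hsplit : Vm n - z • (1 : Matrix (Fin n) (Fin n) ℂ)
      = (Vm n - w • (1 : Matrix (Fin n) (Fin n) ℂ)) + (w - z) • 1 := by
    rw [sub_smul]
    abel
  have hone : Matrix.toEuclideanLin ((w - z) • (1 : Matrix (Fin n) (Fin n) ℂ)) x
      = (w - z) • x := by
    rw [map_smul, LinearMap.smul_apply, Matrix.toLpLin_one, LinearMap.id_apply]
  rw [hsplit, map_add, LinearMap.add_apply, hone]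
  refine (norm_add_le _ _).trans ?_
  rw [norm_smul]
  nlinarith [norm_nonneg x]

lemma pspec_Vm_subset_cDisc {n : ℕ} (hn : 1 ≤ n) {ε : ℝ} (hε : 0 ≤ ε) :
    pspec (ε + epsV n) (Vm n)
      ⊆ cDisc (1 + ε + min (epsV n) (Real.sqrt (2 * epsV n * ε))) := by
  intro z hz
  have he := epsV_nonneg n
  have hs : 0 ≤ √(2 * epsV n * ε) := Real.sqrt_nonneg _
  have hsq : √(2 * epsV n * ε) ^ 2 = 2 * epsV n * ε := Real.sq_sqrt (by positivity)
  change ‖z‖ ≤ _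
  rcases le_or_gt ‖z‖ 1 with h | h
  · have := le_min he hs
    linarith
  have hle : √(epsV n ^ 2 + (‖z‖ - 1) ^ 2) ≤ ε + epsV n :=
    (sqrt_le_sval_Vm_sub hn h.le).trans hz
  have hmain := (Real.sqrt_le_iff.mp hle).2
  have h1 : ‖z‖ - 1 ≤ ε + epsV n := le_of_sq_le_sq (by nlinarith) (by linarith)
  have h2 : ‖z‖ - 1 ≤ ε + √(2 * epsV n * ε) :=
    le_of_sq_le_sq (by nlinarith [mul_nonneg hε hs]) (by linarith)
  have : ‖z‖ - 1 - ε ≤ min (epsV n) (√(2 * epsV n * ε)) :=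
    le_min (by linarith) (by linarith)
  linarith

lemma SigmaV_eq_pspec {n : ℕ} (hn : 1 ≤ n) (ε : ℝ) :
    SigmaV n ε = pspec (ε + epsV n) (Vm n) := by
  have hunion : ⋃ m : Fin n, pspec (ε + epsV n) (Vm (m + 1)) = pspec (ε + epsV n) (Vm n) := by
    refine Set.Subset.antisymm (Set.iUnion_subset fun m => ?_) ?_
    · exact pspec_Vm_mono_dim (by omega) m.isLt _
    · obtain ⟨k, rfl⟩ : ∃ k, n = k + 1 := ⟨n - 1, by omega⟩
      exact Set.subset_iUnion (fun m : Fin (k + 1) => pspec (ε + epsV (k + 1)) (Vm (m + 1)))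
        (Fin.last k)
  unfold SigmaV
  rw [hunion]
  split_ifs
  · rfl
  · refine Set.inter_eq_right.mpr (pspec_mono _ ?_)
    have := epsV_antitone (Nat.sub_le n 2)
    linarith

end SpecInclJL

open SpecInclJL in
/-- **Proposition 5.1 (τ-method inclusion set for the Jordan block).** For
every `N > 1`, `n ∈ {1,…,N−1}` and ε ≥ 0:
`(1+ε)𝔻̄ ⊆ Σ^n_ε(V_N) = Spec_{ε+ε_n} V_n ⊆ (1+ε+min{ε_n,√(2ε_nε)})𝔻̄`;
in particular `Σ^n_0(V_N) = 𝔻̄`. -/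
theorem jordan_tau_inclusion_set (N : ℕ) (hN : 1 < N)
    (n : ℕ) (hn : 1 ≤ n) (hnN : n ≤ N - 1) (ε : ℝ) (hε : 0 ≤ ε) :
    cDisc (1 + ε) ⊆ SigmaV n ε ∧
    SigmaV n ε = pspec (ε + epsV n) (Vm n) ∧
    SigmaV n ε ⊆ cDisc (1 + ε + min (epsV n) (Real.sqrt (2 * epsV n * ε))) ∧
    SigmaV n 0 = cDisc 1 := by
  have heq := SigmaV_eq_pspec hn
  refine ⟨?_, heq ε, ?_, Set.Subset.antisymm ?_ ?_⟩
  · rw [heq]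
    exact cDisc_subset_pspec_Vm hn hε
  · rw [heq]
    exact pspec_Vm_subset_cDisc hn hε
  · rw [heq]
    simpa [epsV_nonneg n] using pspec_Vm_subset_cDisc hn le_rfl
  · rw [heq]
    simpa using cDisc_subset_pspec_Vm hn le_rfl
end
end
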